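/- arXiv:1310.5995 — 6 statements merged into one kernel-verified Lean document; each statement's English description precedes it below -/
import Mathlib

section
/- Assume g satisfies hypotheses (UM) and (FC) and g'(κ) < 0, and let φ be a wavefront profile with speed c > 0 and delay h ≥ 0. Then φ is either eventually monotone (i.e. monotone on some interval [T, +∞)) or slowly oscillating about κ. -/
open Real Filter Set Topology

noncomputable section

/-- Characteristic function `z² − cz − 1 + k·e^{−zch}` (real version). -/
def chi (k c h : ℝ) : ℝ → ℝ := fun z => z ^ 2 - c * z - 1 + k * Real.exp (-(z * c * h))

/-- Hypothesis (UM): `g : [0,∞) → [0,∞)` is continuous, has exactly one positive local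
extremum point `θ` which is a global maximum point, has exactly two fixed points `0` and
`κ > 0`, is differentiable at `0` and at `κ` with `g'(0) = g₀ > 1` and `g'(κ) = gκ < 1`,
`g(x) > x` on `(0,κ)` and `g(x) < x` for `x > κ`. -/
structure UMHyp (g : ℝ → ℝ) (θ κ g₀ gκ : ℝ) : Prop where
  cont : ContinuousOn g (Ici 0)
  nonneg : ∀ x ∈ Ici (0:ℝ), 0 ≤ g x
  theta_pos : 0 < θ
  kappa_pos : 0 < κ
  unique_ext : ∀ x : ℝ, 0 < x → ((IsLocalMax g x ∨ IsLocalMin g x) ↔ x = θ)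
  global_max : ∀ x ∈ Ici (0:ℝ), g x ≤ g θ
  fixed_pts : ∀ x ∈ Ici (0:ℝ), (g x = x ↔ x = 0 ∨ x = κ)
  deriv0 : HasDerivWithinAt g g₀ (Ici 0) 0
  derivκ : HasDerivWithinAt g gκ (Ici 0) κ
  g0_gt_one : 1 < g₀
  gκ_lt_one : gκ < 1
  above_id : ∀ x : ℝ, 0 < x → x < κ → x < g x
  below_id : ∀ x : ℝ, κ < x → g x < x

/-- A wavefront profile with speed `c` (and delay `h`): a positive `C²` solution of
`φ'' − cφ' − φ + g(φ(· − ch)) = 0` with `φ(−∞) = 0` and `φ(+∞) = κ`. -/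
structure Wavefront (g : ℝ → ℝ) (κ c h : ℝ) (φ : ℝ → ℝ) : Prop where
  smooth : ContDiff ℝ 2 φ
  pos : ∀ t, 0 < φ t
  eqn : ∀ t, deriv (deriv φ) t - c * deriv φ t - φ t + g (φ (t - c * h)) = 0
  lim_bot : Tendsto φ atBot (𝓝 0)
  lim_top : Tendsto φ atTop (𝓝 κ)

/-- The set `𝕂 = [−ch, 0] ∪ {1}`. -/
def sigK (c h : ℝ) : Set ℝ := Icc (-(c * h)) 0 ∪ {1}

/-- `scGe c h v k` : the function `v` has at least `k` sign changes on `𝕂`. -/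
def scGe (c h : ℝ) (v : ℝ → ℝ) (k : ℕ) : Prop :=
  ∃ t : Fin (k + 1) → ℝ, StrictMono t ∧ (∀ i, t i ∈ sigK c h) ∧
    ∀ i : Fin k, v (t i.castSucc) * v (t i.succ) < 0

/-- The function `φ̄_t : 𝕂 → ℝ`, `φ̄_t(s) = φ(t+s) − κ` for `s ∈ [−ch,0]`, `φ̄_t(1) = φ'(t)`. -/
def phibar (φ : ℝ → ℝ) (κ t : ℝ) : ℝ → ℝ :=
  fun s => if s = 1 then deriv φ t else φ (t + s) - κ

/-- `φ` slowly oscillates about `κ`: `φ − κ` has zeros in every neighbourhood of `+∞`, is not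
eventually of one sign, and `sc(φ̄_t) ∈ {1,2}` for all large `t`. -/
def SlowlyOscillating (φ : ℝ → ℝ) (κ c h : ℝ) : Prop :=
  (∀ T : ℝ, ∃ t ≥ T, φ t = κ) ∧
  (∀ T : ℝ, ∃ t ≥ T, κ < φ t) ∧
  (∀ T : ℝ, ∃ t ≥ T, φ t < κ) ∧
  ∃ a : ℝ, ∀ t ≥ a, scGe c h (phibar φ κ t) 1 ∧ ¬ scGe c h (phibar φ κ t) 3

/-- `φ` is eventually monotone: monotone on some interval `[T, +∞)`. -/
def EvMonotone (φ : ℝ → ℝ) : Prop :=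
  ∃ T : ℝ, MonotoneOn φ (Ici T) ∨ AntitoneOn φ (Ici T)

/-- Hypothesis (FC): `(g(x) − κ)(x − κ) < 0` on `[g²(θ), g(θ)] \ {κ}`. -/
def FCHyp (g : ℝ → ℝ) (θ κ : ℝ) : Prop :=
  ∀ x ∈ Icc (g (g θ)) (g θ), x ≠ κ → (g x - κ) * (x - κ) < 0

/-- The second order delay equation `φ'' = cφ' + φ - g(φ(· - τ))`, with `φ₁ = φ'`. -/
structure DelayWave (g : ℝ → ℝ) (c τ : ℝ) (φ φ₁ : ℝ → ℝ) : Prop where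
  hasDerivAt : ∀ t, HasDerivAt φ (φ₁ t) t
  hasDerivAt_deriv : ∀ t, HasDerivAt φ₁ (c * φ₁ t + φ t - g (φ (t - τ))) t

/-! ### Calculus lemmas -/

theorem mul_exp_le_of_mul_le_deriv {u u' : ℝ → ℝ} {l a b : ℝ} (hab : a ≤ b)
    (hu : ∀ s, HasDerivAt u (u' s) s) (h : ∀ s ∈ Icc a b, l * u s ≤ u' s) :
    u a * exp (l * (b - a)) ≤ u b := by
  have hd : ∀ s, HasDerivAt (fun s => u s * exp (l * (b - s)))
      (u' s * exp (l * (b - s)) + u s * (exp (l * (b - s)) * (l * (0 - 1)))) s := fun s =>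
    (hu s).mul ((((hasDerivAt_const s b).sub (hasDerivAt_id s)).const_mul l).exp)
  have hm : MonotoneOn (fun s => u s * exp (l * (b - s))) (Icc a b) := by
    refine monotoneOn_of_deriv_nonneg (convex_Icc a b)
      (fun s _ => (hd s).continuousAt.continuousWithinAt)
      (fun s _ => (hd s).differentiableAt.differentiableWithinAt) ?_
    intro s hs
    rw [interior_Icc] at hs
    rw [(hd s).deriv]
    nlinarith [h s (Ioo_subset_Icc_self hs), exp_pos (l * (b - s))]
  have := hm (left_mem_Icc.2 hab) (right_mem_Icc.2 hab) hab
  simpa using this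

theorem le_mul_exp_of_deriv_le_mul {u u' : ℝ → ℝ} {l a b : ℝ} (hab : a ≤ b)
    (hu : ∀ s, HasDerivAt u (u' s) s) (h : ∀ s ∈ Icc a b, u' s ≤ l * u s) :
    u b ≤ u a * exp (l * (b - a)) := by
  have := mul_exp_le_of_mul_le_deriv (l := l) (u := fun s => -u s) (u' := fun s => -u' s) hab
    (fun s => (hu s).neg) (fun s hs => by have := h s hs; linarith)
  linarith

theorem add_mul_le_of_le_deriv {u u' : ℝ → ℝ} {d a b : ℝ} (hab : a ≤ b)
    (hu : ∀ s, HasDerivAt u (u' s) s) (h : ∀ s ∈ Icc a b, d ≤ u' s) :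
    u a + d * (b - a) ≤ u b := by
  have := mul_exp_le_of_mul_le_deriv (l := 0) (u := fun s => u s - d * s)
    (u' := fun s => u' s - d * 1) hab
    (fun s => (hu s).sub ((hasDerivAt_id s).const_mul d)) (fun s hs => by have := h s hs; linarith)
  simp at this
  linarith

theorem IsLocalMin.second_deriv_nonneg {f f₁ : ℝ → ℝ} {t A : ℝ}
    (hf : ∀ s, HasDerivAt f (f₁ s) s) (hf₁ : HasDerivAt f₁ A t) (hm : IsLocalMin f t) :
    f₁ t = 0 ∧ 0 ≤ A := by
  have h0 : f₁ t = 0 := hm.hasDerivAt_eq_zero (hf t)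
  refine ⟨h0, ?_⟩
  by_contra! hA
  have hd : deriv f = f₁ := funext fun s => (hf s).deriv
  have hd' : deriv (fun s => -f s) = fun s => -f₁ s := funext fun s => (hf s).neg.deriv
  have hmax : IsLocalMin (fun s => -f s) t := by
    apply isLocalMin_of_deriv_deriv_pos
    · rw [hd', hf₁.fun_neg.deriv]; linarith
    · simp [hd', h0]
    · exact (hf t).continuousAt.neg
  have heq : f =ᶠ[𝓝 t] fun _ => f t := by
    filter_upwards [hm, hmax] with s h1 h2
    linarith
  have h3 : f₁ =ᶠ[𝓝 t] fun _ => 0 := by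
    have := heq.deriv
    rw [hd] at this
    simpa using this
  have h4 := h3.deriv_eq
  rw [hf₁.deriv, deriv_const] at h4
  linarith

theorem IsLocalMax.second_deriv_nonpos {f f₁ : ℝ → ℝ} {t A : ℝ}
    (hf : ∀ s, HasDerivAt f (f₁ s) s) (hf₁ : HasDerivAt f₁ A t) (hm : IsLocalMax f t) :
    f₁ t = 0 ∧ A ≤ 0 := by
  have := IsLocalMin.second_deriv_nonneg (f := fun s => -f s) (f₁ := fun s => -f₁ s)
    (fun s => (hf s).neg) hf₁.neg hm.neg
  constructor <;> linarith [this.1, this.2]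

theorem abs_sub_sub_le_of_deriv_near {F F₁ : ℝ → ℝ} {s A K e r : ℝ} (hK : 0 ≤ K)
    (hr : |r| ≤ 1) (hF : ∀ u, HasDerivAt F (F₁ u) u)
    (h : ∀ u, |u - s| ≤ 1 → |F₁ u - A| ≤ K * |u - s| + e) :
    |F (s + r) - F s - r * A| ≤ K * r ^ 2 + e * |r| := by
  have hd : ∀ u ∈ uIcc s (s + r),
      HasDerivWithinAt (fun u => F u - A * u) (F₁ u - A * 1) (uIcc s (s + r)) u :=
    fun u _ => ((hF u).sub ((hasDerivAt_id u).const_mul A)).hasDerivWithinAt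
  have hb : ∀ u ∈ uIcc s (s + r), ‖F₁ u - A * 1‖ ≤ K * |r| + e := by
    intro u hu
    have h1 : |u - s| ≤ |r| := by
      have := abs_sub_left_of_mem_uIcc hu
      simpa [abs_sub_comm] using this
    have := h u (h1.trans hr)
    rw [mul_one, Real.norm_eq_abs]
    nlinarith
  have := (convex_uIcc s (s + r)).norm_image_sub_le_of_norm_hasDerivWithin_le hd hb
    left_mem_uIcc right_mem_uIcc
  simp only [Real.norm_eq_abs, add_sub_cancel_left] at this
  calc |F (s + r) - F s - r * A| = |F (s + r) - A * (s + r) - (F s - A * s)| := by ring_nf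
    _ ≤ (K * |r| + e) * |r| := this
    _ = K * r ^ 2 + e * |r| := by rw [← sq_abs r]; ring

theorem abs_sub_le_of_deriv_bound {F F₁ : ℝ → ℝ} {s u K : ℝ}
    (hF : ∀ u, HasDerivAt F (F₁ u) u) (hu : |u - s| ≤ 1)
    (h : ∀ u, |u - s| ≤ 1 → |F₁ u| ≤ K) : |F u - F s| ≤ K * |u - s| := by
  have := abs_sub_sub_le_of_deriv_near (A := 0) (K := 0) (e := K) (r := u - s) le_rfl hu hF
    (fun v hv => by simpa using h v hv)
  simpa using this

theorem hasDerivAt_of_tendsto_of_taylor {ι : Type*} {U : Filter ι} [U.NeBot]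
    {F F₁ : ι → ℝ → ℝ} {f : ℝ → ℝ} {s A C : ℝ} (hf : ∀ s, Tendsto (fun i => F i s) U (𝓝 (f s)))
    (hf₁ : Tendsto (fun i => F₁ i s) U (𝓝 A))
    (h : ∀ ε > 0, ∀ᶠ i in U, ∀ r, |r| ≤ 1 →
      |F i (s + r) - F i s - r * F₁ i s| ≤ C * r ^ 2 + ε * |r|) :
    HasDerivAt f A s := by
  have key : ∀ r, |r| ≤ 1 → |f (s + r) - f s - r * A| ≤ C * r ^ 2 := by
    intro r hr
    have hε : ∀ ε > 0, |f (s + r) - f s - r * A| ≤ C * r ^ 2 + ε * |r| := by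
      intro ε hε
      have ht : Tendsto (fun i => |F i (s + r) - F i s - r * F₁ i s|) U
          (𝓝 |f (s + r) - f s - r * A|) :=
        (((hf (s + r)).sub (hf s)).sub (hf₁.const_mul r)).abs
      exact le_of_tendsto ht ((h ε hε).mono fun i hi => hi r hr)
    refine le_of_forall_pos_le_add fun ε h0 => (hε ε h0).trans ?_
    nlinarith
  rw [hasDerivAt_iff_isLittleO_nhds_zero]
  have h1 : (fun r : ℝ => f (s + r) - f s - r • A) =O[𝓝 0] fun r : ℝ => r ^ 2 := by
    refine Asymptotics.IsBigO.of_bound |C| ?_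
    filter_upwards [Metric.closedBall_mem_nhds (0 : ℝ) one_pos] with r hr
    rw [Metric.mem_closedBall, dist_zero_right, Real.norm_eq_abs] at hr
    rw [Real.norm_eq_abs, Real.norm_eq_abs, ← abs_mul, smul_eq_mul]
    exact (key r hr).trans (le_abs_self _)
  exact h1.trans_isLittleO (Asymptotics.isLittleO_pow_id one_lt_two)

/-! ### Behaviour of positive solutions at `-∞` -/

theorem exists_roots_of_char_poly (c : ℝ) :
    ∃ α β : ℝ, α < 0 ∧ 0 < β ∧ α + β = c ∧ α * β = -1 := by
  have h1 : |c| < √(c ^ 2 + 4) := by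
    rw [← Real.sqrt_sq_eq_abs]
    exact Real.sqrt_lt_sqrt (sq_nonneg c) (by linarith)
  have h2 : √(c ^ 2 + 4) ^ 2 = c ^ 2 + 4 := Real.sq_sqrt (by positivity)
  refine ⟨(c - √(c ^ 2 + 4)) / 2, (c + √(c ^ 2 + 4)) / 2, ?_, ?_, by ring, by nlinarith⟩
  · linarith [le_abs_self c]
  · linarith [neg_abs_le c]

section PositiveSolution

variable {g φ φ₁ : ℝ → ℝ} {c τ α β : ℝ}

theorem DelayWave.root_mul_le_deriv (H : DelayWave g c τ φ φ₁) (hg : ∀ x, 0 ≤ x → 0 ≤ g x)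
    (hpos : ∀ t, 0 < φ t) (hα : α < 0) (hβ : 0 < β) (hs : α + β = c) (hp : α * β = -1) (t : ℝ) :
    α * φ t ≤ φ₁ t := by
  by_contra! hlt
  have hw : ∀ s, HasDerivAt (fun s => φ₁ s - α * φ s)
      (c * φ₁ s + φ s - g (φ (s - τ)) - α * φ₁ s) s :=
    fun s => (H.hasDerivAt_deriv s).sub ((H.hasDerivAt s).const_mul α)
  have hneg : ∀ s, t ≤ s → φ₁ s ≤ φ₁ t - α * φ t := by
    intro s hts
    have h1 := le_mul_exp_of_deriv_le_mul (l := β) hts hw (fun u _ => by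
      have := hg _ (hpos (u - τ)).le
      have e : β * (φ₁ u - α * φ u) = c * φ₁ u + φ u - α * φ₁ u := by
        linear_combination (-φ u) * hp + φ₁ u * hs
      linarith)
    have h2 : 1 ≤ exp (β * (s - t)) := Real.one_le_exp (by nlinarith)
    have h3 := hpos s
    nlinarith
  set d := φ₁ t - α * φ t with hd
  have hd0 : d < 0 := by linarith
  have hs' : t ≤ t + φ t / (-d) := by
    have : 0 < φ t / (-d) := div_pos (hpos t) (by linarith)
    linarith
  have h4 := add_mul_le_of_le_deriv (u := fun s => -φ s) (u' := fun s => -φ₁ s) (d := -d) hs'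
    (fun s => (H.hasDerivAt s).neg) (fun s hs => by have := hneg s hs.1; linarith)
  have h5 : -d * (t + φ t / (-d) - t) = φ t := by
    rw [add_sub_cancel_left, mul_div_cancel₀ _ (by linarith : -d ≠ 0)]
  have := hpos (t + φ t / (-d))
  linarith

theorem DelayWave.deriv_le_root_mul (H : DelayWave g c τ φ φ₁) (hg : ∀ x, 0 ≤ x → 0 ≤ g x)
    (hpos : ∀ t, 0 < φ t) (hα : α < 0) (hβ : 0 < β) (hs : α + β = c) (hp : α * β = -1) (t : ℝ) :
    φ₁ t ≤ β * φ t := by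
  by_contra! hlt
  have hw : ∀ s, HasDerivAt (fun s => φ₁ s - β * φ s)
      (c * φ₁ s + φ s - g (φ (s - τ)) - β * φ₁ s) s :=
    fun s => (H.hasDerivAt_deriv s).sub ((H.hasDerivAt s).const_mul β)
  have hge : ∀ s, s ≤ t → φ₁ t - β * φ t ≤ φ₁ s := by
    intro s hts
    have h1 := le_mul_exp_of_deriv_le_mul (l := α) hts hw (fun u _ => by
      have := hg _ (hpos (u - τ)).le
      have e : α * (φ₁ u - β * φ u) = c * φ₁ u + φ u - β * φ₁ u := by
        linear_combination (-φ u) * hp + φ₁ u * hs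
      linarith)
    have h2 : exp (α * (t - s)) ≤ 1 := Real.exp_le_one_iff.2 (by nlinarith)
    have h3 := hpos s
    have h4 := exp_pos (α * (t - s))
    by_contra! hc
    have : φ₁ s - β * φ s < φ₁ t - β * φ t := by nlinarith
    by_cases h0 : 0 ≤ φ₁ s - β * φ s <;> nlinarith
  set d := φ₁ t - β * φ t with hd
  have hd0 : 0 < d := by linarith
  have hs' : t - φ t / d ≤ t := by
    have : 0 < φ t / d := div_pos (hpos t) hd0
    linarith
  have h4 := add_mul_le_of_le_deriv (d := d) hs' H.hasDerivAt (fun s hs => hge s hs.2)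
  have h5 : d * (t - (t - φ t / d)) = φ t := by
    field_simp
    ring
  have := hpos (t - φ t / d)
  linarith

/-- A Harnack inequality. -/
theorem le_exp_mul_of_abs_deriv_le {φ φ₁ : ℝ → ℝ} {M : ℝ} (hd : ∀ t, HasDerivAt φ (φ₁ t) t)
    (h : ∀ t, |φ₁ t| ≤ M * φ t) (t s : ℝ) :
    φ (t + s) ≤ exp (M * |s|) * φ t := by
  rcases le_total 0 s with hs | hs
  · have := le_mul_exp_of_deriv_le_mul (l := M) (a := t) (b := t + s) (by linarith) hd
      (fun u _ => (abs_le.1 (h u)).2)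
    rw [abs_of_nonneg hs]
    simpa [mul_comm] using this
  · have := mul_exp_le_of_mul_le_deriv (l := -M) (a := t + s) (b := t) (by linarith) hd
      (fun u _ => by linarith [(abs_le.1 (h u)).1])
    rw [abs_of_nonpos hs]
    have h2 : exp (M * -s) * exp (-M * (t - (t + s))) = 1 := by
      rw [← Real.exp_add, Real.exp_eq_one_iff]; ring
    have h3 := exp_pos (M * -s)
    calc φ (t + s) = exp (M * -s) * (φ (t + s) * exp (-M * (t - (t + s)))) := by
          linear_combination (-φ (t + s)) * h2
      _ ≤ exp (M * -s) * φ t := by gcongr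

/-- For the linear equation with coefficient `k > 1`, the logarithmic derivative of a positive
solution has no nonpositive minimum. -/
theorem DelayWave.not_logDeriv_min_nonpos {k ρ : ℝ} {y v : ℝ → ℝ} (hc : 0 < c) (hτ : 0 ≤ τ)
    (H : DelayWave (fun x => k * x) c τ y v) (hk : 1 < k) (hρ : ρ ≤ 0) (hy : ∀ s, 0 ≤ y s)
    (hy0 : y 0 = 1) (hv0 : v 0 = ρ) (hz : ∀ s, ρ * y s ≤ v s) : False := by
  obtain ⟨α, β, hα, hβ, hs, hp⟩ := exists_roots_of_char_poly c
  set z : ℝ → ℝ := fun s => v s - ρ * y s with hzdef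
  set z₁ : ℝ → ℝ := fun s => c * v s + y s - k * y (s - τ) - ρ * v s with hz₁def
  have hyτ : ∀ s, HasDerivAt (fun s => y (s - τ)) (v (s - τ)) s := fun s =>
    (H.hasDerivAt (s - τ)).comp_sub_const s τ
  have dz : ∀ s, HasDerivAt z (z₁ s) s := fun s =>
    (H.hasDerivAt_deriv s).sub ((H.hasDerivAt s).const_mul ρ)
  have dz₁ : ∀ s, HasDerivAt z₁ (c * z₁ s + z s - k * z (s - τ)) s := by
    intro s
    have := ((((H.hasDerivAt_deriv s).const_mul c).add (H.hasDerivAt s)).sub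
      ((hyτ s).const_mul k)).sub ((H.hasDerivAt_deriv s).const_mul ρ)
    refine this.congr_deriv ?_
    simp only [hzdef, hz₁def]
    ring
  have hz0 : ∀ s, 0 ≤ z s := fun s => sub_nonneg.2 (hz s)
  have hmin : ∀ s, z s = 0 → IsLocalMin z s := fun s h =>
    Filter.Eventually.of_forall fun u => by rw [h]; exact hz0 u
  have hz00 : z 0 = 0 := by simp [hzdef, hy0, hv0]
  obtain ⟨h1, h2⟩ := IsLocalMin.second_deriv_nonneg dz (dz₁ 0) (hmin 0 hz00)
  have hzτ : z (-τ) = 0 := by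
    rw [h1, hz00, zero_sub] at h2
    have := hz0 (-τ)
    nlinarith
  have hz₁τ : z₁ (-τ) = 0 := (hmin _ hzτ).hasDerivAt_eq_zero (dz (-τ))
  have hW : ∀ s, -τ ≤ s → z₁ s ≤ α * z s := by
    intro s hτs
    have := le_mul_exp_of_deriv_le_mul (l := β) (u := fun s => z₁ s - α * z s) hτs
      (fun s => (dz₁ s).sub ((dz s).const_mul α)) (fun u _ => by
        have h3 : 0 ≤ k * z (u - τ) := mul_nonneg (by linarith) (hz0 (u - τ))
        have e : β * (z₁ u - α * z u) = c * z₁ u + z u - α * z₁ u := by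
          linear_combination (-z u) * hp + z₁ u * hs
        linarith)
    simp only [hz₁τ, hzτ] at this
    linarith
  have hzz : ∀ s, -τ ≤ s → z s = 0 := by
    intro s hτs
    have := le_mul_exp_of_deriv_le_mul hτs dz (fun u hu => hW u hu.1)
    rw [hzτ, zero_mul] at this
    exact le_antisymm this (hz0 s)
  have hanti : y 0 ≤ y (-τ) * exp (0 * (0 - -τ)) :=
    le_mul_exp_of_deriv_le_mul (by linarith) H.hasDerivAt (fun u hu => by
      have h := hzz u hu.1
      simp only [hzdef] at h
      nlinarith [hy u])
  simp only [zero_mul, Real.exp_zero, mul_one, hy0] at hanti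
  simp only [hz₁def, hy0, hv0, zero_sub] at h1
  nlinarith

theorem exists_tendsto_ultrafilter_of_mem_Icc {ι : Type*} (U : Ultrafilter ι) {F : ι → ℝ}
    {a b : ℝ} (h : ∀ i, F i ∈ Icc a b) : ∃ x, Tendsto F U (𝓝 x) := by
  obtain ⟨x, -, hx⟩ := (isCompact_Icc (a := a) (b := b)).ultrafilter_le_nhds' (U.map F)
    (Ultrafilter.mem_map.2 (Filter.univ_mem' h))
  exact ⟨x, hx⟩

/-- The rescaled translates of a positive solution vanishing at `-∞` converge, along any
ultrafilter tending to `-∞`, to a solution of the linearized equation. -/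
theorem DelayWave.exists_linear_limit {M k : ℝ} (H : DelayWave g c τ φ φ₁) (hc : 0 < c)
    (hτ : 0 ≤ τ) (hk : 0 < k) (hM : 0 ≤ M) (hpos : ∀ t, 0 < φ t)
    (hφM : ∀ t, |φ₁ t| ≤ M * φ t) (hlim : Tendsto φ atBot (𝓝 0))
    (hg : ∀ ε > 0, ∃ δ > 0, ∀ x, 0 < x → x < δ → |g x - k * x| ≤ ε * x)
    (U : Ultrafilter ℝ) (hU : ↑U ≤ (atBot : Filter ℝ)) :
    ∃ y v : ℝ → ℝ, DelayWave (fun x => k * x) c τ y v ∧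
      (∀ s, Tendsto (fun t => φ (t + s) / φ t) U (𝓝 (y s))) ∧
      (∀ s, Tendsto (fun t => φ₁ (t + s) / φ t) U (𝓝 (v s))) := by
  have hY : ∀ t s, φ (t + s) / φ t ≤ exp (M * |s|) := fun t s =>
    (div_le_iff₀ (hpos t)).2 (le_exp_mul_of_abs_deriv_le H.hasDerivAt hφM t s)
  have hY0 : ∀ t s, 0 ≤ φ (t + s) / φ t := fun t s => (div_pos (hpos _) (hpos _)).le
  have hV : ∀ t s, |φ₁ (t + s) / φ t| ≤ M * (φ (t + s) / φ t) := fun t s => by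
    rw [abs_div, abs_of_pos (hpos t), ← mul_div_assoc]
    exact div_le_div_of_nonneg_right (hφM _) (hpos t).le
  have hVE : ∀ t s, |φ₁ (t + s) / φ t| ≤ M * exp (M * |s|) := fun t s =>
    (hV t s).trans (mul_le_mul_of_nonneg_left (hY t s) hM)
  choose y hy using fun s => exists_tendsto_ultrafilter_of_mem_Icc U
    (F := fun t => φ (t + s) / φ t) (fun t => ⟨hY0 t s, hY t s⟩)
  choose v hv using fun s => exists_tendsto_ultrafilter_of_mem_Icc U
    (F := fun t => φ₁ (t + s) / φ t) (fun t => abs_le.1 (hVE t s))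
  have dY : ∀ t s, HasDerivAt (fun s => φ (t + s) / φ t) (φ₁ (t + s) / φ t) s := fun t s =>
    ((H.hasDerivAt (t + s)).comp_const_add t s).div_const _
  have dYτ : ∀ t s, HasDerivAt (fun s => φ (t + (s - τ)) / φ t) (φ₁ (t + (s - τ)) / φ t) s :=
    fun t s => (dY t (s - τ)).comp_sub_const s τ
  have dV : ∀ t s, HasDerivAt (fun s => φ₁ (t + s) / φ t)
      ((c * φ₁ (t + s) + φ (t + s) - g (φ (t + s - τ))) / φ t) s := fun t s =>
    ((H.hasDerivAt_deriv (t + s)).comp_const_add t s).div_const _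
  refine ⟨y, v, ?_, hy, hv⟩
  -- uniform estimates on the window of radius one around `s`
  have key : ∀ s, ∃ E, 0 ≤ E ∧ (∀ t u, |u - s| ≤ 1 → φ (t + u) / φ t ≤ E) ∧
      (∀ t u, |u - s| ≤ 1 → φ (t + (u - τ)) / φ t ≤ E) := by
    intro s
    refine ⟨exp (M * (|s| + 1 + τ)), (exp_pos _).le, fun t u hu => (hY t u).trans ?_,
      fun t u hu => (hY t _).trans ?_⟩
    · gcongr
      have := abs_le.1 hu
      rcases abs_cases u with h | h <;> rcases abs_cases s with h' | h' <;> linarith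
    · gcongr
      have := abs_le.1 hu
      rcases abs_cases (u - τ) with h | h <;> rcases abs_cases s with h' | h' <;> linarith
  have hsmall : ∀ s, ∀ ε > 0, ∀ᶠ t in (U : Filter ℝ), ∀ u, |u - s| ≤ 1 →
      |g (φ (t + u - τ)) / φ t - k * (φ (t + (u - τ)) / φ t)| ≤
        ε * (φ (t + (u - τ)) / φ t) := by
    intro s ε hε
    obtain ⟨δ, hδ, hgδ⟩ := hg ε hε
    obtain ⟨T, hT⟩ := eventually_atBot.1 (hlim.eventually (gt_mem_nhds hδ))
    refine hU ?_
    filter_upwards [eventually_le_atBot (T - |s| - 1)] with t ht u hu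
    have h1 : t + u - τ ≤ T := by linarith [(abs_le.1 hu).2, le_abs_self s]
    have h2 := hgδ _ (hpos _) (hT _ h1)
    rw [← add_sub_assoc, ← mul_div_assoc, ← mul_div_assoc, ← sub_div, abs_div,
      abs_of_pos (hpos t)]
    exact div_le_div_of_nonneg_right h2 (hpos t).le
  -- Lipschitz bounds
  have hLip : ∀ s, ∃ K, 0 ≤ K ∧ ∀ᶠ t in (U : Filter ℝ), ∀ u, |u - s| ≤ 1 →
      |φ₁ (t + u) / φ t - φ₁ (t + s) / φ t| ≤ K * |u - s| := by
    intro s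
    obtain ⟨E, hE, hE1, hE2⟩ := key s
    refine ⟨c * (M * E) + E + (k + 1) * E, by positivity, ?_⟩
    filter_upwards [hsmall s 1 one_pos] with t ht u hu
    refine abs_sub_le_of_deriv_bound (dV t) hu fun u hu => ?_
    have e1 := hE1 t u hu
    have e2 := hE2 t u hu
    have e3 := ht u hu
    have e4 := hV t u
    have e5 := hY0 t u
    have e6 := hY0 t (u - τ)
    rw [sub_div, add_div, mul_div_assoc]
    rw [abs_le] at e3 e4 ⊢
    have e7 : M * (φ (t + u) / φ t) ≤ M * E := by gcongr
    have e8 : k * (φ (t + (u - τ)) / φ t) ≤ k * E := by gcongr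
    have e9 : 0 ≤ k * (φ (t + (u - τ)) / φ t) := by positivity
    constructor <;> nlinarith
  refine ⟨fun s => ?_, fun s => ?_⟩
  · obtain ⟨K, hK, hKt⟩ := hLip s
    refine hasDerivAt_of_tendsto_of_taylor (F₁ := fun t s => φ₁ (t + s) / φ t) (C := K)
      hy (hv s) fun ε hε => ?_
    filter_upwards [hKt] with t ht r hr
    exact abs_sub_sub_le_of_deriv_near hK hr (dY t)
      (fun u hu => (ht u hu).trans (by linarith))
  · obtain ⟨K, hK, hKt⟩ := hLip s
    obtain ⟨E, hE, hE1, hE2⟩ := key s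
    refine hasDerivAt_of_tendsto_of_taylor (F₁ := fun t s => c * (φ₁ (t + s) / φ t) +
      φ (t + s) / φ t - k * (φ (t + (s - τ)) / φ t)) (C := c * K + M * E + k * (M * E)) hv
      ((((hv s).const_mul c).add (hy s)).sub ((hy (s - τ)).const_mul k)) fun ε hε => ?_
    filter_upwards [hKt, hsmall s (ε / (E + 1)) (by positivity)] with t ht ht' r hr
    refine abs_sub_sub_le_of_deriv_near (by positivity) hr (dV t) (fun u hu => ?_)
    have e1 := ht u hu
    have e2 := ht' u hu
    have e3 : |φ (t + u) / φ t - φ (t + s) / φ t| ≤ M * E * |u - s| :=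
      abs_sub_le_of_deriv_bound (dY t) hu fun u hu =>
        (hV t u).trans (mul_le_mul_of_nonneg_left (hE1 t u hu) hM)
    have e4 : |φ (t + (u - τ)) / φ t - φ (t + (s - τ)) / φ t| ≤ M * E * |u - s| :=
      abs_sub_le_of_deriv_bound (dYτ t) hu fun u hu =>
        (hV t (u - τ)).trans (mul_le_mul_of_nonneg_left (hE2 t u hu) hM)
    have e5 : ε / (E + 1) * (φ (t + (u - τ)) / φ t) ≤ ε := by
      rw [div_mul_eq_mul_div, div_le_iff₀ (by positivity)]
      exact mul_le_mul_of_nonneg_left ((hE2 t u hu).trans (by linarith)) hε.le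
    have e2' := e2.trans e5
    rw [sub_div, add_div, mul_div_assoc]
    rw [abs_le] at e1 e2' e3 e4 ⊢
    constructor <;> nlinarith

/-- Positive solutions vanishing at `-∞` are increasing near `-∞`. -/
theorem DelayWave.eventually_deriv_pos {k : ℝ} (H : DelayWave g c τ φ φ₁) (hc : 0 < c)
    (hτ : 0 ≤ τ) (hk : 1 < k) (hg0 : ∀ x, 0 ≤ x → 0 ≤ g x) (hpos : ∀ t, 0 < φ t)
    (hlim : Tendsto φ atBot (𝓝 0))
    (hg : ∀ ε > 0, ∃ δ > 0, ∀ x, 0 < x → x < δ → |g x - k * x| ≤ ε * x) :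
    ∃ T, ∀ t ≤ T, 0 < φ₁ t := by
  obtain ⟨α, β, hα, hβ, hs, hp⟩ := exists_roots_of_char_poly c
  have hlow := H.root_mul_le_deriv hg0 hpos hα hβ hs hp
  have hupp := H.deriv_le_root_mul hg0 hpos hα hβ hs hp
  set r : ℝ → ℝ := fun t => φ₁ t / φ t with hr
  have hrlow : ∀ t, α ≤ r t := fun t => (le_div_iff₀ (hpos t)).2 (hlow t)
  have hrupp : ∀ t, r t ≤ β := fun t => (div_le_iff₀ (hpos t)).2 (hupp t)
  have hb1 : IsBoundedUnder (· ≥ ·) atBot r := isBoundedUnder_of ⟨α, hrlow⟩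
  have hb2 : IsBoundedUnder (· ≤ ·) atBot r := isBoundedUnder_of ⟨β, hrupp⟩
  by_contra hcon
  have hfreq : ∃ᶠ t in atBot, r t ≤ 0 := by
    intro hev
    refine hcon ?_
    obtain ⟨T, hT⟩ := eventually_atBot.1 hev
    exact ⟨T, fun t ht => (div_pos_iff_of_pos_right (hpos t)).1 (not_le.1 (hT t ht))⟩
  set ρ := liminf r atBot with hρdef
  have hρ : ρ ≤ 0 := liminf_le_of_frequently_le hfreq hb1
  have hev : ∀ ε > 0, ∀ᶠ t in atBot, ρ - ε < r t := fun ε hε =>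
    eventually_lt_of_lt_liminf (by linarith) hb1
  have hclus : MapClusterPt ρ atBot r := by
    rw [mapClusterPt_iff_frequently]
    intro S hS
    obtain ⟨ε, hε, hεS⟩ := Metric.mem_nhds_iff.1 hS
    have h1 : ∃ᶠ t in atBot, r t < ρ + ε :=
      frequently_lt_of_liminf_lt hb2.isCobounded_ge (by linarith)
    refine (h1.and_eventually (hev ε hε)).mono fun t ht => hεS ?_
    rw [Metric.mem_ball, Real.dist_eq, abs_lt]
    constructor <;> linarith [ht.1, ht.2]
  obtain ⟨U, hU, hUr⟩ := mapClusterPt_iff_ultrafilter.1 hclus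
  have hM : ∀ t, |φ₁ t| ≤ (β - α) * φ t := fun t => by
    have := hpos t
    rw [abs_le]
    constructor <;> nlinarith [hlow t, hupp t]
  obtain ⟨y, v, hyv, hy, hv⟩ := H.exists_linear_limit hc hτ (by linarith) (by linarith) hpos hM
    hlim hg U hU
  refine hyv.not_logDeriv_min_nonpos hc hτ hk hρ
    (fun s => ge_of_tendsto' (hy s) fun t => (div_pos (hpos _) (hpos _)).le) ?_ ?_ fun s => ?_
  · refine tendsto_nhds_unique (hy 0) (tendsto_const_nhds.congr fun t => ?_)
    rw [add_zero, div_self (hpos t).ne']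
  · refine tendsto_nhds_unique (hv 0) (hUr.congr fun t => ?_)
    rw [add_zero]
  · have hε : ∀ ε > 0, (ρ - ε) * y s ≤ v s := by
      intro ε hε
      refine le_of_tendsto_of_tendsto ((hy s).const_mul (ρ - ε)) (hv s) (hU ?_)
      filter_upwards [(tendsto_atBot_add_const_right atBot s tendsto_id).eventually (hev ε hε)]
        with t ht
      rw [← mul_div_assoc]
      exact div_le_div_of_nonneg_right ((lt_div_iff₀ (hpos _)).1 ht).le (hpos t).le
    have ht : Tendsto (fun ε => (ρ - ε) * y s) (𝓝[>] 0) (𝓝 (ρ * y s)) := by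
      have : ContinuousAt (fun ε => (ρ - ε) * y s) 0 := by fun_prop
      simpa using this.tendsto.mono_left (nhdsWithin_le_nhds (s := Ioi 0))
    exact le_of_tendsto ht (eventually_mem_nhdsWithin.mono fun ε h => hε ε h)

end PositiveSolution

/-! ### Sign alternation -/

/-- `Alternates x n p`: there are `p₀ < p₁ < ⋯ < pₙ = p` at which `x` alternates in sign, with
`x p₀ < 0`. -/
def Alternates (x : ℝ → ℝ) : ℕ → ℝ → Prop
  | 0, p => x p < 0
  | n + 1, p => (∃ q < p, Alternates x n q) ∧ (-1) ^ (n + 1) * x p < 0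

section Alternation

variable {x x₁ : ℝ → ℝ} {τ : ℝ}

theorem Alternates.sign {n : ℕ} {p : ℝ} (h : Alternates x n p) : (-1) ^ n * x p < 0 := by
  cases n with
  | zero => simpa [Alternates] using h
  | succ n => exact h.2

theorem Alternates.succ {n : ℕ} {p q : ℝ} (h : Alternates x n p) (hpq : p < q)
    (hx : x p * x q < 0) : Alternates x (n + 1) q := by
  refine ⟨⟨p, hpq, h⟩, ?_⟩
  have := h.sign
  rw [pow_succ]
  rcases neg_one_pow_eq_or ℝ n with e | e <;> rw [e] at this ⊢ <;> by_contra! <;> nlinarith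

theorem Alternates.exists_pos {n : ℕ} {p : ℝ} (h : Alternates x (n + 1) p) :
    ∃ q ≤ p, 0 < x q := by
  induction n generalizing p with
  | zero => exact ⟨p, le_rfl, by simpa using h.2⟩
  | succ n ih =>
    obtain ⟨q, hq, hqn⟩ := h.1
    obtain ⟨r, hr, hr0⟩ := ih hqn
    exact ⟨r, hr.trans hq.le, hr0⟩

/-- A chain can be moved to the right, possibly becoming longer. -/
theorem Alternates.exists_ge {n : ℕ} {p a : ℝ} (h : Alternates x n p) (hpa : p ≤ a)
    (ha : x a ≠ 0) : ∃ k ≥ n, Alternates x k a := by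
  rcases lt_or_gt_of_ne (mul_ne_zero (pow_ne_zero n (by norm_num : (-1 : ℝ) ≠ 0)) ha) with h1 | h1
  · refine ⟨n, le_rfl, ?_⟩
    cases n with
    | zero => simpa [Alternates] using h1
    | succ n =>
      obtain ⟨q, hq, hqn⟩ := h.1
      exact ⟨⟨q, hq.trans_le hpa, hqn⟩, h1⟩
  · have hne : p ≠ a := by
      rintro rfl
      exact lt_asymm h.sign h1
    refine ⟨n + 1, n.le_succ, ⟨p, lt_of_le_of_ne hpa hne, h⟩, ?_⟩
    rw [pow_succ]
    linarith

theorem exists_lt_gt_of_hasDerivAt_neg {y : ℝ → ℝ} {d t a : ℝ} (hd : HasDerivAt y d t)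
    (hd0 : d < 0) (hat : a < t) : ∃ s ∈ Ioo a t, y t < y s := by
  have h1 : Tendsto (slope y t) (𝓝[<] t) (𝓝 d) :=
    (hasDerivWithinAt_iff_tendsto_slope' (by simp)).1 (hd.hasDerivWithinAt (s := Iio t))
  have h2 := h1.eventually (gt_mem_nhds hd0)
  obtain ⟨s, hs, hs'⟩ := (h2.and (Ioo_mem_nhdsLT hat)).exists
  refine ⟨s, hs', ?_⟩
  rw [slope_def_field, div_neg_iff] at hs
  rcases hs with hs | hs <;> linarith [hs'.2, hs.1, hs.2]

theorem exists_extremum_of_sign_change (hx : ∀ t, HasDerivAt x (x₁ t) t)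
    (hext : ∀ σ : ℝ, σ = 1 ∨ σ = -1 → ∀ m, IsLocalMax (fun s => σ * x s) m → 0 < σ * x m →
      σ * x (m - τ) < 0) {σ a q t : ℝ} (hσ : σ = 1 ∨ σ = -1) (haq : a < q) (hqt : q ≤ t)
    (ha : σ * x a < 0) (hq : 0 < σ * x q) (ht : σ * x t ≤ 0 ∨ σ * x₁ t < 0) :
    ∃ m ∈ Ioo a t, 0 < σ * x m ∧ σ * x (m - τ) < 0 := by
  have hd : ∀ t, HasDerivAt (fun s => σ * x s) (σ * x₁ t) t := fun t => (hx t).const_mul σ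
  have hat : a < t := haq.trans_le hqt
  obtain ⟨m, hm, hmax⟩ := isCompact_Icc.exists_isMaxOn (nonempty_Icc.2 hat.le)
    (fun s _ => (hd s).continuousAt.continuousWithinAt)
  have hmax' : ∀ s ∈ Icc a t, σ * x s ≤ σ * x m := hmax
  have hmq := hmax' q ⟨haq.le, hqt⟩
  have hma : m ≠ a := by rintro rfl; linarith
  have hmt : m ≠ t := by
    rintro rfl
    rcases ht with h | h
    · linarith
    · obtain ⟨s, hs, hs'⟩ := exists_lt_gt_of_hasDerivAt_neg (hd m) h hat
      exact absurd (hmax' s (Ioo_subset_Icc_self hs)) (not_le.2 hs')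
  have hmI : m ∈ Ioo a t := ⟨lt_of_le_of_ne hm.1 hma.symm, lt_of_le_of_ne hm.2 hmt⟩
  exact ⟨m, hmI, by linarith,
    hext σ hσ m (hmax.isLocalMax (Icc_mem_nhds hmI.1 hmI.2)) (by linarith)⟩

/-- Descent: a chain up to time `t` produces a chain up to time `t - τ` which is shorter by one
or two sign changes. -/
theorem Alternates.descent (hx : ∀ t, HasDerivAt x (x₁ t) t)
    (hext : ∀ σ : ℝ, σ = 1 ∨ σ = -1 → ∀ m, IsLocalMax (fun s => σ * x s) m → 0 < σ * x m →
      σ * x (m - τ) < 0) {n : ℕ} {q t : ℝ} (h : Alternates x (n + 1) q) (hqt : q ≤ t)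
    (ht : (-1) ^ n * x t ≤ 0 ∨ (-1) ^ n * x₁ t < 0) :
    ∃ m < t, 0 < (-1) ^ n * x m ∧ Alternates x n (m - τ) := by
  induction n generalizing q t with
  | zero =>
    obtain ⟨⟨p, hp, hp0⟩, hq⟩ := h
    obtain ⟨m, hm, hm1, hm2⟩ := exists_extremum_of_sign_change hx hext (σ := 1) (.inl rfl) hp hqt
      (by simpa using hp0.sign) (by simpa using hq) (by simpa using ht)
    exact ⟨m, hm.2, by simpa using hm1, by simpa [Alternates] using hm2⟩
  | succ n ih =>
    obtain ⟨⟨p, hp, hpn⟩, hq⟩ := h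
    rw [pow_succ] at hq
    obtain ⟨m', hm', hm'1, hm'2⟩ := ih hpn hp.le
      (.inl (by rw [pow_succ] at hq; linarith))
    obtain ⟨m, hm, hm1, hm2⟩ := exists_extremum_of_sign_change hx hext
      (neg_one_pow_eq_or ℝ (n + 1)) hm' hqt (by rw [pow_succ]; linarith) (by linarith) ht
    exact ⟨m, hm.2, hm1, ⟨m' - τ, by linarith [hm.1], hm'2⟩, hm2⟩

theorem Alternates.length_bounded (hτ : 0 < τ) (hx : ∀ t, HasDerivAt x (x₁ t) t)
    (hext : ∀ σ : ℝ, σ = 1 ∨ σ = -1 → ∀ m, IsLocalMax (fun s => σ * x s) m → 0 < σ * x m →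
      σ * x (m - τ) < 0) {T : ℝ} (hT : ∀ t ≤ T, x t < 0) (t : ℝ) :
    ∃ N : ℕ, ∀ n p, p ≤ t → Alternates x n p → n ≤ N := by
  have key : ∀ j : ℕ, ∀ t, t ≤ T + j * τ → ∀ n p, p ≤ t → Alternates x n p → n ≤ 2 * j := by
    intro j
    induction j with
    | zero =>
      intro t ht n p hp h
      cases n with
      | zero => simp
      | succ n =>
        obtain ⟨q, hq, hq0⟩ := h.exists_pos
        have := hT q (by simp at ht; linarith)
        linarith
    | succ j ih =>
      intro t ht n p hp h
      match n, h with
      | 0, _ => omega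
      | 1, _ => omega
      | n + 2, h =>
        obtain ⟨⟨q, hq, hqn⟩, hp2⟩ := h
        obtain ⟨m, hm, -, hmn⟩ := hqn.descent hx hext hq.le
          (.inl (by rw [pow_succ, pow_succ] at hp2; linarith))
        have := ih (t - τ) (by push_cast at ht; linarith) n (m - τ) (by linarith) hmn
        omega
  obtain ⟨j, hj⟩ := exists_nat_ge ((t - T) / τ)
  rw [div_le_iff₀ hτ] at hj
  exact ⟨2 * j, key j t (by linarith)⟩

theorem not_three_sign_changes (hτ : 0 < τ) (hx : ∀ t, HasDerivAt x (x₁ t) t)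
    (hext : ∀ σ : ℝ, σ = 1 ∨ σ = -1 → ∀ m, IsLocalMax (fun s => σ * x s) m → 0 < σ * x m →
      σ * x (m - τ) < 0) {T : ℝ} (hT : ∀ t ≤ T, x t < 0) {t p q r : ℝ} (hp : t - τ ≤ p)
    (hpq : p < q) (hqr : q < r) (hrt : r ≤ t) (h1 : x p * x q < 0) (h2 : x q * x r < 0)
    (h3 : (∃ s, r < s ∧ s ≤ t ∧ x r * x s < 0) ∨ x r * x₁ t < 0) : False := by
  classical
  obtain ⟨B, hB⟩ := Alternates.length_bounded hτ hx hext hT (t - τ)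
  let P : ℕ → Prop := fun n => ∃ u ≤ t - τ, Alternates x n u
  have hP0 : P 0 := ⟨min T (t - τ), min_le_right _ _, hT _ (min_le_left _ _)⟩
  obtain ⟨u, hu, hN⟩ : P (Nat.findGreatest P B) := Nat.findGreatest_spec (Nat.zero_le B) hP0
  have hmax : ∀ n u, u ≤ t - τ → Alternates x n u → n ≤ Nat.findGreatest P B := fun n u hu h =>
    Nat.le_findGreatest (hB n u hu h) ⟨u, hu, h⟩
  have hp0 : x p ≠ 0 := by
    intro h
    simp [h] at h1
  obtain ⟨k, hk, hkp⟩ := hN.exists_ge (hu.trans hp) hp0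
  have hr := (hkp.succ hpq h1).succ hqr h2
  have hsr := hr.sign
  have hdesc : ∃ m < t, 0 < (-1) ^ (k + 1) * x m ∧ Alternates x (k + 1) (m - τ) := by
    rcases h3 with ⟨s, hrs, hst, h3⟩ | h3
    · have hs := (hr.succ hrs h3).sign
      obtain ⟨m, hm, h⟩ := hr.descent hx hext hrs.le
        (.inl (by rw [pow_succ, pow_succ] at hs; linarith))
      exact ⟨m, hm.trans_le hst, h⟩
    · refine hr.descent hx hext hrt (.inr ?_)
      rw [pow_succ] at hsr
      rcases neg_one_pow_eq_or ℝ (k + 1) with e | e <;> rw [e] at hsr ⊢ <;> by_contra! <;> nlinarith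
  obtain ⟨m, hm, -, hmk⟩ := hdesc
  have := hmax _ _ (by linarith) hmk
  omega

end Alternation

/-! ### The nonlinearity -/

section Nonlinearity

variable {g : ℝ → ℝ} {θ κ g₀ gκ : ℝ}

theorem UMHyp.map_kappa (hUM : UMHyp g θ κ g₀ gκ) : g κ = κ :=
  (hUM.fixed_pts κ hUM.kappa_pos.le).2 (.inr rfl)

theorem UMHyp.kappa_lt_max (hUM : UMHyp g θ κ g₀ gκ) (hgκ : gκ < 0) : κ < g θ := by
  by_contra! h
  have hd : HasDerivAt g gκ κ := hUM.derivκ.hasDerivAt (Ici_mem_nhds hUM.kappa_pos)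
  have hm : IsLocalMax g κ := by
    filter_upwards [Ici_mem_nhds hUM.kappa_pos] with x hx
    rw [hUM.map_kappa]
    exact (hUM.global_max x hx).trans h
  linarith [hm.hasDerivAt_eq_zero hd]

theorem UMHyp.map_max_lt_kappa (hUM : UMHyp g θ κ g₀ gκ) (hFC : FCHyp g θ κ) (hgκ : gκ < 0) :
    g (g θ) < κ := by
  have h1 := hUM.kappa_lt_max hgκ
  have h2 := hUM.global_max (g θ) (hUM.kappa_pos.trans h1).le
  have h3 := hFC (g θ) ⟨h2, le_rfl⟩ h1.ne'
  by_contra! h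
  nlinarith

theorem UMHyp.map_lt_kappa (hUM : UMHyp g θ κ g₀ gκ) (hFC : FCHyp g θ κ) (hgκ : gκ < 0) {x : ℝ}
    (hx : κ < x) (hx' : x ≤ g θ) : g x < κ := by
  have h1 := hUM.map_max_lt_kappa hFC hgκ
  have h3 := hFC x ⟨(h1.trans hx).le, hx'⟩ hx.ne'
  by_contra! h
  nlinarith

theorem UMHyp.kappa_lt_map (hUM : UMHyp g θ κ g₀ gκ) (hFC : FCHyp g θ κ) (hgκ : gκ < 0) {x : ℝ}
    (hx : g (g θ) ≤ x) (hx' : x < κ) : κ < g x := by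
  have h3 := hFC x ⟨hx, (hx'.trans (hUM.kappa_lt_max hgκ)).le⟩ hx'.ne
  by_contra! h
  nlinarith

theorem UMHyp.map_max_le (hUM : UMHyp g θ κ g₀ gκ) (hFC : FCHyp g θ κ) (hgκ : gκ < 0) {x : ℝ}
    (hx : κ ≤ x) (hx' : x ≤ g θ) : g (g θ) ≤ g x := by
  have h1 := hUM.kappa_lt_max hgκ
  have h2 := hUM.map_max_lt_kappa hFC hgκ
  obtain ⟨p, hp, hmin⟩ := isCompact_Icc.exists_isMinOn (nonempty_Icc.2 h1.le)
    (hUM.cont.mono fun y hy => hUM.kappa_pos.le.trans hy.1)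
  have hpx : g p ≤ g x := hmin ⟨hx, hx'⟩
  have hpθ : g p ≤ g (g θ) := hmin (right_mem_Icc.2 h1.le)
  rcases eq_or_ne p (g θ) with rfl | hpe
  · exact hpx
  rcases eq_or_ne p κ with rfl | hpk
  · rw [hUM.map_kappa] at hpθ
    linarith
  have hpI : p ∈ Ioo κ (g θ) := ⟨lt_of_le_of_ne hp.1 hpk.symm, lt_of_le_of_ne hp.2 hpe⟩
  have := (hUM.unique_ext p (hUM.kappa_pos.trans hpI.1)).1
    (.inr (hmin.isLocalMin (Icc_mem_nhds hpI.1 hpI.2)))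
  subst this
  linarith

/-- Below `κ`, the map `g` is increasing as long as its values stay below `κ`. -/
theorem UMHyp.map_lt_map (hUM : UMHyp g θ κ g₀ gκ) (hFC : FCHyp g θ κ) (hgκ : gκ < 0) {x y : ℝ}
    (hx : 0 < x) (hxy : x < y) (hy : y < κ) (hgy : g y < κ) : g x < g y := by
  by_contra! hle
  have h2 := hUM.map_max_lt_kappa hFC hgκ
  have hgb := hUM.kappa_lt_map hFC hgκ le_rfl h2
  have hyb : y < g (g θ) := by
    by_contra! h
    linarith [hUM.kappa_lt_map hFC hgκ h hy]
  obtain ⟨p, hp, hmin⟩ := isCompact_Icc.exists_isMinOn (nonempty_Icc.2 (hxy.trans hyb).le)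
    (hUM.cont.mono fun y hy => hx.le.trans hy.1)
  have hmin' : ∀ z ∈ Icc x (g (g θ)), g p ≤ g z := hmin
  have hpy := hmin' y ⟨hxy.le, hyb.le⟩
  obtain ⟨r, hr, hrmin⟩ : ∃ r ∈ Ioo x (g (g θ)), g r ≤ g p := by
    rcases eq_or_ne p x with rfl | hpx
    · exact ⟨y, ⟨hxy, hyb⟩, hle⟩
    · refine ⟨p, ⟨lt_of_le_of_ne hp.1 hpx.symm, lt_of_le_of_ne hp.2 ?_⟩, le_rfl⟩
      rintro rfl
      linarith
  have hloc : IsLocalMin g r := by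
    filter_upwards [Icc_mem_nhds hr.1 hr.2] with z hz
    exact hrmin.trans (hmin' z hz)
  have hrθ := (hUM.unique_ext r (hx.trans hr.1)).1 (.inr hloc)
  subst hrθ
  linarith [hUM.kappa_lt_max hgκ]

theorem UMHyp.abs_map_sub_le (hUM : UMHyp g θ κ g₀ gκ) {ε : ℝ} (hε : 0 < ε) :
    ∃ δ > 0, ∀ x, 0 < x → x < δ → |g x - g₀ * x| ≤ ε * x := by
  have h0 : g 0 = 0 := (hUM.fixed_pts 0 (by simp)).2 (.inl rfl)
  have h := (hasDerivWithinAt_iff_isLittleO.1 hUM.deriv0).def hε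
  obtain ⟨δ, hδ, hδ'⟩ := Metric.mem_nhdsWithin_iff.1 h
  refine ⟨δ, hδ, fun x hx hxδ => ?_⟩
  have := hδ' ⟨by simpa [abs_of_pos hx] using hxδ, hx.le⟩
  simpa [h0, abs_of_pos hx, mul_comm] using this

end Nonlinearity

/-! ### Extrema of the profile -/

section Profile

variable {g φ φ₁ : ℝ → ℝ} {θ κ g₀ gκ c τ : ℝ}

theorem DelayWave.map_le_of_isLocalMin (H : DelayWave g c τ φ φ₁) {m : ℝ}
    (hm : IsLocalMin φ m) : g (φ (m - τ)) ≤ φ m := by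
  have := hm.second_deriv_nonneg H.hasDerivAt (H.hasDerivAt_deriv m)
  rw [this.1] at this
  linarith [this.2]

theorem DelayWave.le_map_of_isLocalMax (H : DelayWave g c τ φ φ₁) {m : ℝ}
    (hm : IsLocalMax φ m) : φ m ≤ g (φ (m - τ)) := by
  have := hm.second_deriv_nonpos H.hasDerivAt (H.hasDerivAt_deriv m)
  rw [this.1] at this
  linarith [this.2]

theorem DelayWave.continuous (H : DelayWave g c τ φ φ₁) : Continuous φ :=
  continuous_iff_continuousAt.2 fun t => (H.hasDerivAt t).continuousAt

theorem exists_isLocalMax_lt (hφ : Continuous φ) (hlim : Tendsto φ atBot (𝓝 0)) {s t : ℝ}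
    (ht : 0 < φ t) (hst : s < t) (hs : φ t ≤ φ s) :
    ∃ m < t, IsLocalMax φ m ∧ ∀ u ≤ t, φ u ≤ φ m := by
  obtain ⟨T, hT⟩ := eventually_atBot.1 (hlim.eventually (gt_mem_nhds ht))
  obtain ⟨p, hp, hmax⟩ := isCompact_Icc.exists_isMaxOn
    (nonempty_Icc.2 (min_le_right T t)) hφ.continuousOn
  have hmax' : ∀ u ∈ Icc (min T t) t, φ u ≤ φ p := hmax
  have hpt := hmax' t ⟨min_le_right _ _, le_rfl⟩
  have hall : ∀ u ≤ t, φ u ≤ φ p := by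
    intro u hu
    rcases le_total u T with h | h
    · linarith [hT u h]
    · exact hmax' u ⟨(min_le_left _ _).trans h, hu⟩
  have hloc : ∀ m < t, φ p ≤ φ m → IsLocalMax φ m := fun m hm h => by
    filter_upwards [Iic_mem_nhds hm] with u hu
    exact (hall u hu).trans h
  rcases hp.2.lt_or_eq with h | rfl
  · exact ⟨p, h, hloc p h le_rfl, hall⟩
  · exact ⟨s, hst, hloc s hst hs, fun u hu => (hall u hu).trans hs⟩

theorem DelayWave.le_max (H : DelayWave g c τ φ φ₁) (hUM : UMHyp g θ κ g₀ gκ) (hgκ : gκ < 0)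
    (hpos : ∀ t, 0 < φ t) (hbot : Tendsto φ atBot (𝓝 0)) (htop : Tendsto φ atTop (𝓝 κ)) (t : ℝ) :
    φ t ≤ g θ := by
  by_contra! h
  have h1 := (hUM.kappa_lt_max hgκ).trans h
  obtain ⟨s, hs, hst⟩ := ((htop.eventually (gt_mem_nhds h1)).and (eventually_gt_atTop t)).exists
  obtain ⟨m, -, hm, hsm⟩ := exists_isLocalMax_lt H.continuous hbot (hpos s) hst hs.le
  have := hsm t hst.le
  linarith [H.le_map_of_isLocalMax hm, hUM.global_max _ (hpos (m - τ)).le]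

/-- A local minimum below `κ` whose delayed value is also below `κ` is preceded by another one,
which is at least as low as that delayed value. -/
theorem DelayWave.exists_lower_isLocalMin (H : DelayWave g c τ φ φ₁) (hUM : UMHyp g θ κ g₀ gκ)
    (hFC : FCHyp g θ κ) (hgκ : gκ < 0) (hτ : 0 ≤ τ) (hpos : ∀ t, 0 < φ t)
    (hbot : Tendsto φ atBot (𝓝 0)) (htop : Tendsto φ atTop (𝓝 κ)) {t : ℝ}
    (hmin : IsLocalMin φ t) (ht : φ t < κ) (htτ : φ (t - τ) < κ) :
    ∃ m, IsLocalMin φ m ∧ φ m < κ ∧ φ (m - τ) < κ ∧ φ m ≤ φ (t - τ) := by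
  have h1 := hUM.above_id _ (hpos (t - τ)) htτ
  have h2 := H.map_le_of_isLocalMin hmin
  have hut : t - τ < t := by
    refine lt_of_le_of_ne (by linarith) fun h => ?_
    rw [h] at h1 h2
    linarith
  obtain ⟨r, hr, hrt⟩ : ∃ r, φ t ≤ φ r ∧ r < t := by
    have := (hmin.filter_mono nhdsWithin_le_nhds : ∀ᶠ r in 𝓝[<] t, φ t ≤ φ r)
    exact (this.and self_mem_nhdsWithin).exists
  obtain ⟨s, hs, hsmax, hsall⟩ := exists_isLocalMax_lt H.continuous hbot (hpos t) hrt hr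
  have h3 := H.le_map_of_isLocalMax hsmax
  have h4 : φ (t - τ) ≤ φ (s - τ) := by
    by_contra! h
    have := hUM.map_lt_map hFC hgκ (hpos (s - τ)) h htτ (by linarith)
    linarith [hsall t le_rfl]
  obtain ⟨m, hm, hmmin⟩ := isCompact_Icc.exists_isMinOn
    (nonempty_Icc.2 (by linarith : s - τ ≤ t)) H.continuous.continuousOn
  have hm' : ∀ z ∈ Icc (s - τ) t, φ m ≤ φ z := hmmin
  have hmu := hm' (t - τ) ⟨by linarith, hut.le⟩
  obtain ⟨p, hp, hpm⟩ : ∃ p ∈ Ioo (s - τ) t, φ p ≤ φ m := by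
    rcases eq_or_ne m (s - τ) with rfl | hne
    · exact ⟨t - τ, ⟨by linarith, hut⟩, h4⟩
    · refine ⟨m, ⟨lt_of_le_of_ne hm.1 hne.symm, lt_of_le_of_ne hm.2 ?_⟩, le_rfl⟩
      rintro rfl
      linarith
  have hploc : IsLocalMin φ p := by
    filter_upwards [Icc_mem_nhds hp.1 hp.2] with z hz
    exact hpm.trans (hm' z hz)
  refine ⟨p, hploc, by linarith, ?_, by linarith⟩
  by_contra! h
  have h5 := hUM.map_max_le hFC hgκ h (H.le_max hUM hgκ hpos hbot htop _)
  have h6 := H.map_le_of_isLocalMin hploc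
  have := hUM.kappa_lt_map hFC hgκ (by linarith : g (g θ) ≤ φ (t - τ)) htτ
  linarith

theorem DelayWave.kappa_lt_of_isLocalMin (H : DelayWave g c τ φ φ₁) (hUM : UMHyp g θ κ g₀ gκ)
    (hFC : FCHyp g θ κ) (hgκ : gκ < 0) (hc : 0 < c) (hτ : 0 ≤ τ) (hpos : ∀ t, 0 < φ t)
    (hbot : Tendsto φ atBot (𝓝 0)) (htop : Tendsto φ atTop (𝓝 κ)) {m : ℝ}
    (hmin : IsLocalMin φ m) (hm : φ m < κ) : κ < φ (m - τ) := by
  by_contra! hle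
  have hlt : φ (m - τ) < κ := by
    refine lt_of_le_of_ne hle fun h => ?_
    have := H.map_le_of_isLocalMin hmin
    rw [h, hUM.map_kappa] at this
    linarith
  obtain ⟨T, hT⟩ := H.eventually_deriv_pos hc hτ hUM.g0_gt_one (fun x hx => hUM.nonneg x hx) hpos
    hbot fun ε hε => hUM.abs_map_sub_le hε
  have hTm : ∀ t, IsLocalMin φ t → T < t := by
    intro t ht
    by_contra! h
    linarith [hT t h, ht.hasDerivAt_eq_zero (H.hasDerivAt t)]
  obtain ⟨ε, hε, hφε⟩ : ∃ ε > 0, ∀ t ≥ T - τ, ε ≤ φ t := by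
    obtain ⟨S, hS⟩ := eventually_atTop.1
      (htop.eventually (lt_mem_nhds (half_lt_self hUM.kappa_pos)))
    obtain ⟨p, -, hp⟩ := isCompact_Icc.exists_isMinOn
      (nonempty_Icc.2 (le_max_left (T - τ) S)) H.continuous.continuousOn
    refine ⟨min (φ p) (κ / 2), lt_min (hpos p) (half_pos hUM.kappa_pos), fun t ht => ?_⟩
    rcases le_total t S with h | h
    · exact (min_le_left _ _).trans (hp ⟨ht, h.trans (le_max_right _ _)⟩)
    · exact (min_le_right _ _).trans (hS t h).le
  have hbound : ∀ t, IsLocalMin φ t → φ t < κ → φ (t - τ) < κ →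
      φ (t - τ) ∈ Icc ε (g (g θ)) := by
    intro t h1 h2 h3
    refine ⟨hφε _ (by linarith [hTm t h1]), ?_⟩
    by_contra! h
    linarith [hUM.kappa_lt_map hFC hgκ h.le h3, H.map_le_of_isLocalMin h1]
  obtain ⟨η, hη, hgη⟩ : ∃ η > 0, ∀ x ∈ Icc ε (g (g θ)), x + η ≤ g x := by
    obtain ⟨p, hp, hpmin⟩ := isCompact_Icc.exists_isMinOn ⟨_, hbound m hmin hm hlt⟩
      ((hUM.cont.mono fun y hy => hε.le.trans hy.1).sub continuousOn_id :
        ContinuousOn (fun x => g x - x) (Icc ε (g (g θ))))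
    refine ⟨g p - p, sub_pos.2 (hUM.above_id p (hε.trans_le hp.1)
      (hp.2.trans_lt (hUM.map_max_lt_kappa hFC hgκ))), fun x hx => ?_⟩
    have : g p - p ≤ g x - x := hpmin hx
    linarith
  let V : Set ℝ := φ '' {t | IsLocalMin φ t ∧ φ t < κ ∧ φ (t - τ) < κ}
  have hV : V.Nonempty := ⟨φ m, m, ⟨hmin, hm, hlt⟩, rfl⟩
  have hVb : BddBelow V := ⟨0, by rintro _ ⟨t, -, rfl⟩; exact (hpos t).le⟩
  obtain ⟨_, ⟨t, ⟨h1, h2, h3⟩, rfl⟩, h4⟩ :=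
    exists_lt_of_csInf_lt hV (lt_add_of_pos_right (sInf V) hη)
  obtain ⟨s, hs1, hs2, hs3, hs4⟩ :=
    H.exists_lower_isLocalMin hUM hFC hgκ hτ hpos hbot htop h1 h2 h3
  have h5 : sInf V ≤ φ s := csInf_le hVb ⟨s, ⟨hs1, hs2, hs3⟩, rfl⟩
  linarith [hgη _ (hbound t h1 h2 h3), H.map_le_of_isLocalMin h1]

theorem DelayWave.lt_kappa_of_isLocalMax (H : DelayWave g c τ φ φ₁) (hUM : UMHyp g θ κ g₀ gκ)
    (hFC : FCHyp g θ κ) (hgκ : gκ < 0) (hpos : ∀ t, 0 < φ t) (hbot : Tendsto φ atBot (𝓝 0))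
    (htop : Tendsto φ atTop (𝓝 κ)) {m : ℝ} (hmax : IsLocalMax φ m) (hm : κ < φ m) :
    φ (m - τ) < κ := by
  by_contra! h
  have h1 := H.le_map_of_isLocalMax hmax
  rcases h.lt_or_eq with h | h
  · linarith [hUM.map_lt_kappa hFC hgκ h (H.le_max hUM hgκ hpos hbot htop _)]
  · rw [← h, hUM.map_kappa] at h1
    linarith

/-- At an extremum of the signed deviation from `κ`, the delayed deviation has opposite sign. -/
theorem DelayWave.delayed_neg_of_isLocalMax (H : DelayWave g c τ φ φ₁)
    (hUM : UMHyp g θ κ g₀ gκ) (hFC : FCHyp g θ κ) (hgκ : gκ < 0) (hc : 0 < c) (hτ : 0 ≤ τ)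
    (hpos : ∀ t, 0 < φ t) (hbot : Tendsto φ atBot (𝓝 0)) (htop : Tendsto φ atTop (𝓝 κ))
    (σ : ℝ) (hσ : σ = 1 ∨ σ = -1) (m : ℝ) (hmax : IsLocalMax (fun s => σ * (φ s - κ)) m)
    (hm : 0 < σ * (φ m - κ)) : σ * (φ (m - τ) - κ) < 0 := by
  rcases hσ with rfl | rfl
  · have : IsLocalMax φ m := hmax.mono fun s hs => by linarith
    linarith [H.lt_kappa_of_isLocalMax hUM hFC hgκ hpos hbot htop this (by linarith)]
  · have : IsLocalMin φ m := hmax.mono fun s hs => by linarith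
    linarith [H.kappa_lt_of_isLocalMin hUM hFC hgκ hc hτ hpos hbot htop this (by linarith)]

/-- Negative feedback of `g` about `κ` on its invariant interval. -/
theorem UMHyp.negative_feedback (hUM : UMHyp g θ κ g₀ gκ) (hFC : FCHyp g θ κ) {σ x : ℝ}
    (hσ : σ = 1 ∨ σ = -1) (hx : x ∈ Icc (g (g θ)) (g θ)) (h : 0 ≤ σ * (x - κ)) :
    σ * (g x - κ) ≤ 0 := by
  rcases eq_or_ne x κ with rfl | hne
  · simp [hUM.map_kappa]
  have := hFC x hx hne
  have hne' := sub_ne_zero.2 hne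
  rcases hσ with rfl | rfl
  · have : 0 < x - κ := lt_of_le_of_ne (by linarith) hne'.symm
    by_contra!
    nlinarith
  · have : x - κ < 0 := lt_of_le_of_ne (by linarith) hne'
    by_contra!
    nlinarith

theorem DelayWave.hasDerivAt_deviation (H : DelayWave g c τ φ φ₁) (σ t : ℝ) :
    HasDerivAt (fun s => σ * (φ s - κ)) (σ * φ₁ t) t :=
  ((H.hasDerivAt t).sub_const κ).const_mul σ

theorem DelayWave.hasDerivAt_deriv_deviation (H : DelayWave g c τ φ φ₁) (σ t : ℝ) :
    HasDerivAt (fun s => σ * φ₁ s)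
      (c * (σ * φ₁ t) + σ * (φ t - κ) - σ * (g (φ (t - τ)) - κ)) t :=
  ((H.hasDerivAt_deriv t).const_mul σ).congr_deriv (by ring)

/-- A profile staying on one side of `κ` is eventually monotone. -/
theorem DelayWave.evMonotone_of_nonneg (H : DelayWave g c τ φ φ₁) (hUM : UMHyp g θ κ g₀ gκ)
    (hFC : FCHyp g θ κ) (hc : 0 < c) (hτ : 0 ≤ τ) (htop : Tendsto φ atTop (𝓝 κ))
    {σ S T : ℝ} (hσ : σ = 1 ∨ σ = -1) (hS : ∀ t ≥ S, φ t ∈ Icc (g (g θ)) (g θ))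
    (hT : ∀ t ≥ T, 0 ≤ σ * (φ t - κ)) : EvMonotone φ := by
  have key : ∀ t ≥ max S T + τ, σ * φ₁ t ≤ 0 := by
    intro t ht
    by_contra! hd
    have h1 : ∀ b ≥ t, σ * φ₁ t ≤ σ * φ₁ b := by
      intro b hb
      have := mul_exp_le_of_mul_le_deriv (l := c) hb (H.hasDerivAt_deriv_deviation (κ := κ) σ)
        (fun s hs => by
          have hs1 : s - τ ≥ S := by linarith [hs.1, le_max_left S T]
          have hs2 : s - τ ≥ T := by linarith [hs.1, le_max_right S T]
          linarith [hUM.negative_feedback hFC hσ (hS _ hs1) (hT _ hs2), hT s (by linarith)])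
      refine le_trans ?_ this
      exact le_mul_of_one_le_right hd.le (one_le_exp (mul_nonneg hc.le (by linarith)))
    have hlim : Tendsto (fun s => σ * (φ s - κ)) atTop (𝓝 0) := by
      simpa using (htop.sub_const κ).const_mul σ
    obtain ⟨b, hb, hbt⟩ := ((hlim.eventually (gt_mem_nhds hd)).and
      (eventually_ge_atTop (t + 1))).exists
    have h2 := add_mul_le_of_le_deriv (by linarith : t ≤ b)
      (H.hasDerivAt_deviation (κ := κ) σ) (fun s hs => h1 s hs.1)
    have h3 := hT t (by linarith [le_max_right S T])
    nlinarith
  refine ⟨max S T + τ, ?_⟩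
  rcases hσ with rfl | rfl
  · refine .inr (antitoneOn_of_deriv_nonpos (convex_Ici _) H.continuous.continuousOn
      (fun t _ => (H.hasDerivAt t).differentiableAt.differentiableWithinAt) fun t ht => ?_)
    rw [interior_Ici] at ht
    rw [(H.hasDerivAt t).deriv]
    linarith [key t (le_of_lt ht)]
  · refine .inl (monotoneOn_of_deriv_nonneg (convex_Ici _) H.continuous.continuousOn
      (fun t _ => (H.hasDerivAt t).differentiableAt.differentiableWithinAt) fun t ht => ?_)
    rw [interior_Ici] at ht
    rw [(H.hasDerivAt t).deriv]
    linarith [key t (le_of_lt ht)]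

/-- A segment of one sign with matching derivative at its right end stays of that sign. -/
theorem DelayWave.nonneg_of_segment_nonneg (H : DelayWave g c τ φ φ₁)
    (hUM : UMHyp g θ κ g₀ gκ) (hFC : FCHyp g θ κ) (hτ : 0 < τ) {σ S t : ℝ}
    (hσ : σ = 1 ∨ σ = -1) (hS : ∀ t ≥ S, φ t ∈ Icc (g (g θ)) (g θ)) (ht : S + τ ≤ t)
    (hseg : ∀ s ∈ Icc (t - τ) t, 0 ≤ σ * (φ s - κ)) (hd : 0 ≤ σ * φ₁ t) :
    ∀ s ≥ t, 0 ≤ σ * (φ s - κ) := by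
  obtain ⟨α, β, hα, hβ, hsum, hprod⟩ := exists_roots_of_char_poly c
  have step : ∀ t, S + τ ≤ t → (∀ s ∈ Icc (t - τ) t, 0 ≤ σ * (φ s - κ)) → 0 ≤ σ * φ₁ t →
      (∀ s ∈ Icc t (t + τ), 0 ≤ σ * (φ s - κ)) ∧ 0 ≤ σ * φ₁ (t + τ) := by
    intro t ht hseg hd
    have hfb : ∀ s ∈ Icc t (t + τ), σ * (g (φ (s - τ)) - κ) ≤ 0 := fun s hs =>
      hUM.negative_feedback hFC hσ (hS _ (by linarith [hs.1]))
        (hseg _ ⟨by linarith [hs.1], by linarith [hs.2]⟩)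
    have h0 := hseg t ⟨by linarith, le_rfl⟩
    have hw : ∀ s ∈ Icc t (t + τ), 0 ≤ σ * φ₁ s - α * (σ * (φ s - κ)) := by
      intro s hs
      have := mul_exp_le_of_mul_le_deriv (l := β) hs.1
        (fun r => (H.hasDerivAt_deriv_deviation (κ := κ) σ r).sub
          ((H.hasDerivAt_deviation (κ := κ) σ r).const_mul α))
        (fun r hr => by
          have h1 := hfb r ⟨hr.1, hr.2.trans hs.2⟩
          have h2 : β = c - α := by linarith
          have h3 : β * α = -1 := by linarith
          have h4 : β * (σ * φ₁ r - α * (σ * (φ r - κ))) =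
            (c - α) * (σ * φ₁ r) + σ * (φ r - κ) := by
              rw [mul_sub, ← mul_assoc β α, h3, ← h2]; ring
          simp only [Pi.sub_apply]
          linarith)
      refine le_trans (mul_nonneg ?_ (exp_pos _).le) this
      simp only [Pi.sub_apply]
      nlinarith
    have hy : ∀ s ∈ Icc t (t + τ), 0 ≤ σ * (φ s - κ) := by
      intro s hs
      have := mul_exp_le_of_mul_le_deriv (l := α) hs.1 (H.hasDerivAt_deviation (κ := κ) σ)
        (fun r hr => by linarith [hw r ⟨hr.1, hr.2.trans hs.2⟩])
      exact le_trans (mul_nonneg h0 (exp_pos _).le) this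
    refine ⟨hy, ?_⟩
    have := mul_exp_le_of_mul_le_deriv (l := c) (by linarith : t ≤ t + τ)
      (H.hasDerivAt_deriv_deviation (κ := κ) σ)
      (fun r hr => by linarith [hfb r hr, hy r hr])
    exact le_trans (mul_nonneg hd (exp_pos _).le) this
  have iter : ∀ n : ℕ, (∀ s ∈ Icc (t + n * τ - τ) (t + n * τ), 0 ≤ σ * (φ s - κ)) ∧
      0 ≤ σ * φ₁ (t + n * τ) := by
    intro n
    induction n with
    | zero => simpa using ⟨fun s h1 h2 => hseg s ⟨by linarith, h2⟩, hd⟩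
    | succ n ih =>
      have hn : 0 ≤ n * τ := by positivity
      have := step _ (by linarith) ih.1 ih.2
      have e : t + (n + 1 : ℕ) * τ = t + n * τ + τ := by push_cast; ring
      rw [e, add_sub_cancel_right]
      exact this
  intro s hs
  have hn := Nat.lt_floor_add_one ((s - t) / τ)
  have hn' := Nat.floor_le (div_nonneg (sub_nonneg.2 hs) hτ.le)
  rw [div_lt_iff₀ hτ] at hn
  rw [le_div_iff₀ hτ] at hn'
  exact (iter (⌊(s - t) / τ⌋₊ + 1)).1 s
    ⟨by push_cast; linarith, by push_cast; linarith⟩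

end Profile

section Wavefront

variable {g φ : ℝ → ℝ} {θ κ g₀ gκ c h : ℝ}

theorem Wavefront.delayWave (hφ : Wavefront g κ c h φ) : DelayWave g c (c * h) φ (deriv φ) where
  hasDerivAt t := (hφ.smooth.differentiable (by norm_num) t).hasDerivAt
  hasDerivAt_deriv t := by
    have h1 : ContDiff ℝ 1 (deriv φ) :=
      (contDiff_succ_iff_deriv (n := 1).1 (by simpa [one_add_one_eq_two] using hφ.smooth)).2.2
    exact (h1.differentiable (by norm_num) t).hasDerivAt.congr_deriv (by linarith [hφ.eqn t])

theorem phibar_of_nonpos {s t : ℝ} (hs : s ≤ 0) : phibar φ κ t s = φ (t + s) - κ :=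
  if_neg (by linarith)

theorem phibar_one {t : ℝ} : phibar φ κ t 1 = deriv φ t := if_pos rfl

theorem scGe_one_of_mul_neg {v : ℝ → ℝ} {p q : ℝ} (hp : p ∈ sigK c h) (hq : q ∈ sigK c h)
    (hpq : p < q) (hv : v p * v q < 0) : scGe c h v 1 := by
  refine ⟨![p, q], ?_, ?_, ?_⟩
  · intro i j hij
    fin_cases i <;> fin_cases j <;> simp_all
  · intro i
    fin_cases i <;> simp [hp, hq]
  · intro i
    fin_cases i
    simpa using hv

/-- Without sign changes, the segment and its final slope have a common sign. -/
theorem exists_sign_of_not_scGe_one {v : ℝ → ℝ} (hv : ¬ scGe c h v 1) :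
    ∃ σ : ℝ, (σ = 1 ∨ σ = -1) ∧ ∀ s ∈ sigK c h, 0 ≤ σ * v s := by
  have key : ∀ p ∈ sigK c h, ∀ q ∈ sigK c h, 0 ≤ v p * v q := by
    intro p hp q hq
    by_contra! hlt
    rcases lt_trichotomy p q with hpq | rfl | hpq
    · exact hv (scGe_one_of_mul_neg hp hq hpq hlt)
    · nlinarith
    · exact hv (scGe_one_of_mul_neg hq hp hpq (by linarith))
  by_cases hex : ∃ p ∈ sigK c h, v p < 0
  · obtain ⟨p, hp, hvp⟩ := hex
    refine ⟨-1, .inr rfl, fun s hs => ?_⟩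
    by_contra!
    nlinarith [key p hp s hs]
  · push Not at hex
    exact ⟨1, .inl rfl, fun s hs => by linarith [hex s hs]⟩

theorem mem_Icc_of_mem_sigK_of_lt {p q : ℝ} (hp : p ∈ sigK c h) (hq : q ∈ sigK c h) (hpq : p < q) :
    p ∈ Icc (-(c * h)) 0 := by
  rcases hp with hp | hp
  · exact hp
  · rw [mem_singleton_iff] at hp
    rcases hq with hq | hq
    · linarith [hq.2]
    · rw [mem_singleton_iff] at hq
      linarith

end Wavefront

/-- under (UM), (FC) and `g'(κ) < 0`, every wavefront profile is either
eventually monotone or slowly oscillating about `κ`. -/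
theorem stmt2 (g : ℝ → ℝ) (θ κ g₀ gκ c h : ℝ)
    (hUM : UMHyp g θ κ g₀ gκ) (hFC : FCHyp g θ κ) (hgκ : gκ < 0)
    (hc : 0 < c) (hh : 0 ≤ h)
    (φ : ℝ → ℝ) (hφ : Wavefront g κ c h φ) :
    EvMonotone φ ∨ SlowlyOscillating φ κ c h := by
  have H := hφ.delayWave
  have hch : 0 ≤ c * h := mul_nonneg hc.le hh
  obtain ⟨S, hS⟩ : ∃ S, ∀ t ≥ S, φ t ∈ Icc (g (g θ)) (g θ) := by
    obtain ⟨S, hS⟩ := eventually_atTop.1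
      (hφ.lim_top.eventually (lt_mem_nhds (hUM.map_max_lt_kappa hFC hgκ)))
    exact ⟨S, fun t ht => ⟨(hS t ht).le, H.le_max hUM hgκ hφ.pos hφ.lim_bot hφ.lim_top t⟩⟩
  have hext := H.delayed_neg_of_isLocalMax hUM hFC hgκ hc hch hφ.pos hφ.lim_bot hφ.lim_top
  have hx : ∀ t, HasDerivAt (fun s => φ s - κ) (deriv φ t) t := fun t =>
    (H.hasDerivAt t).sub_const κ
  refine or_iff_not_imp_left.2 fun hmono => ?_
  have hfreq : ∀ σ : ℝ, σ = 1 ∨ σ = -1 → ∀ T, ∃ t ≥ T, σ * (φ t - κ) < 0 := by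
    intro σ hσ T
    by_contra! hT
    exact hmono (H.evMonotone_of_nonneg hUM hFC hc hch hφ.lim_top hσ hS hT)
  have habove : ∀ T : ℝ, ∃ t ≥ T, κ < φ t := fun T => by
    obtain ⟨t, ht, h⟩ := hfreq (-1) (.inr rfl) T
    exact ⟨t, ht, by linarith⟩
  have hbelow : ∀ T : ℝ, ∃ t ≥ T, φ t < κ := fun T => by
    obtain ⟨t, ht, h⟩ := hfreq 1 (.inl rfl) T
    exact ⟨t, ht, by linarith⟩
  have hτ : 0 < c * h := by
    refine lt_of_le_of_ne hch fun h0 => ?_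
    obtain ⟨p, -, hp⟩ := hbelow 0
    obtain ⟨q, hpq, hq⟩ := habove (p + 1)
    obtain ⟨r, hqr, hr⟩ := hbelow q
    obtain ⟨m, -, h1, h2⟩ := exists_extremum_of_sign_change hx hext (σ := 1) (.inl rfl)
      (by linarith : p < q) hqr (by linarith) (by linarith) (.inl (by linarith))
    rw [← h0, sub_zero] at h2
    linarith
  refine ⟨fun T => ?_, habove, hbelow, S + c * h, fun t ht => ⟨?_, ?_⟩⟩
  · obtain ⟨p, hp, hpκ⟩ := hbelow T
    obtain ⟨q, hpq, hqκ⟩ := habove p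
    obtain ⟨z, hz, hzκ⟩ := intermediate_value_Icc hpq H.continuous.continuousOn
      ⟨hpκ.le, hqκ.le⟩
    exact ⟨z, hp.trans hz.1, hzκ⟩
  · by_contra hsc
    obtain ⟨σ, hσ, hsign⟩ := exists_sign_of_not_scGe_one hsc
    have hd := hsign 1 (.inr rfl)
    rw [phibar_one] at hd
    have hseg : ∀ s ∈ Icc (t - c * h) t, 0 ≤ σ * (φ s - κ) := by
      intro s hs
      have := hsign (s - t) (.inl ⟨by linarith [hs.1], by linarith [hs.2]⟩)
      rwa [phibar_of_nonpos (by linarith [hs.2]), add_sub_cancel] at this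
    obtain ⟨s, hs, hs0⟩ := hfreq σ hσ t
    exact hs0.not_ge (H.nonneg_of_segment_nonneg hUM hFC hτ hσ hS ht hseg hd s hs)
  · rintro ⟨u, hu, huK, hsgn⟩
    obtain ⟨T, hT⟩ := eventually_atBot.1 (hφ.lim_bot.eventually (gt_mem_nhds hUM.kappa_pos))
    have h01 : u 0 < u 1 := hu (by decide)
    have h12 : u 1 < u 2 := hu (by decide)
    have h23 : u 2 < u 3 := hu (by decide)
    have hI0 := mem_Icc_of_mem_sigK_of_lt (huK 0) (huK 1) h01
    have hI1 := mem_Icc_of_mem_sigK_of_lt (huK 1) (huK 2) h12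
    have hI2 := mem_Icc_of_mem_sigK_of_lt (huK 2) (huK 3) h23
    have e0 := hsgn 0
    have e1 := hsgn 1
    have e2 := hsgn 2
    change phibar φ κ t (u 0) * phibar φ κ t (u 1) < 0 at e0
    change phibar φ κ t (u 1) * phibar φ κ t (u 2) < 0 at e1
    change phibar φ κ t (u 2) * phibar φ κ t (u 3) < 0 at e2
    rw [phibar_of_nonpos hI0.2, phibar_of_nonpos hI1.2] at e0
    rw [phibar_of_nonpos hI1.2, phibar_of_nonpos hI2.2] at e1
    rw [phibar_of_nonpos hI2.2] at e2
    refine not_three_sign_changes hτ hx hext (fun s hs => sub_neg.2 (hT s hs))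
      (t := t) (p := t + u 0) (q := t + u 1) (r := t + u 2) (by linarith [hI0.1]) (by linarith)
      (by linarith) (by linarith [hI2.2]) e0 e1 ?_
    rcases huK 3 with h3 | h3
    · rw [phibar_of_nonpos h3.2] at e2
      exact .inl ⟨t + u 3, by linarith, by linarith [h3.2], e2⟩
    · rw [mem_singleton_iff.1 h3, phibar_one] at e2
      exact .inr e2

end
end

section
/- Let k < 0 and h > 0 be fixed. Then there exists c* = c*(h) ∈ (0, +∞] such that, for c > 0, the function χ(z) = z² − cz − 1 + k e^{−zch} has three real zeros λ₁ ≤ λ₂ < 0 < λ₃ if and only if c ≤ c*. If c* is finite and c = c*, then χ has a double negative zero λ₁ = λ₂ < 0 (i.e. χ(λ₁) = χ'(λ₁) = 0), while for c > c* the function χ has no negative real zeros. -/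
open Real Filter Set Topology

noncomputable section

/-- The value of `1 / c²` for which `-(exp t) / c` is a zero of `chi k c h`. -/
def zeroLevel (k h t : ℝ) : ℝ :=
  (1 - exp t - k * exp (h * exp t)) / exp t ^ 2

lemma continuous_zeroLevel (k h : ℝ) : Continuous (zeroLevel k h) := by
  unfold zeroLevel
  exact Continuous.div (by fun_prop) (by fun_prop) fun t => by positivity

lemma tendsto_zeroLevel_atBot {k : ℝ} (hk : k < 0) (h : ℝ) :
    Tendsto (zeroLevel k h) atBot atTop := by
  have hexp : Tendsto (fun t : ℝ => exp (-t)) atBot atTop :=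
    tendsto_exp_atTop.comp tendsto_neg_atBot_atTop
  refine tendsto_atTop_mono (fun t => ?_)
    (hexp.atTop_mul_atTop₀ (tendsto_atTop_add_const_right _ (-1) hexp))
  have hpos : 0 < -k * exp (h * exp t) := mul_pos (neg_pos.2 hk) (exp_pos _)
  rw [zeroLevel, le_div_iff₀ (by positivity), exp_neg]
  have : (exp t)⁻¹ * ((exp t)⁻¹ + -1) * exp t ^ 2 = 1 - exp t := by
    field_simp
    ring
  linarith

lemma tendsto_zeroLevel_atTop {k h : ℝ} (hk : k < 0) (hh : 0 < h) :
    Tendsto (zeroLevel k h) atTop atTop := by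
  have hC : 0 < -k * h ^ 3 / 6 := by
    have := neg_pos.2 hk
    positivity
  refine tendsto_atTop_mono' _ ?_
    (tendsto_atTop_add_const_right _ (-1) (tendsto_exp_atTop.const_mul_atTop hC))
  filter_upwards [eventually_ge_atTop 0] with t ht
  have h1 : 1 ≤ exp t := one_le_exp ht
  have h3 : (h * exp t) ^ 3 / 6 ≤ exp (h * exp t) := by
    simpa [Nat.factorial] using pow_div_factorial_le_exp (h * exp t) (by positivity) 3
  have h4 := mul_le_mul_of_nonneg_left h3 (neg_pos.2 hk).le
  rw [zeroLevel, le_div_iff₀ (by positivity)]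
  nlinarith

lemma exists_forall_zeroLevel_le {k h : ℝ} (hk : k < 0) (hh : 0 < h) :
    ∃ t₀, ∀ t, zeroLevel k h t₀ ≤ zeroLevel k h t := by
  refine (continuous_zeroLevel k h).exists_forall_le ?_
  rw [cocompact_eq_atBot_atTop]
  exact (tendsto_zeroLevel_atBot hk h).sup (tendsto_zeroLevel_atTop hk hh)

lemma exists_lt_lt_of_tendsto_atTop {f : ℝ → ℝ} (hf : Continuous f)
    (hbot : Tendsto f atBot atTop) (htop : Tendsto f atTop atTop) {t₀ v : ℝ} (hv : f t₀ < v) :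
    ∃ t₁ t₂, t₁ < t₂ ∧ f t₁ = v ∧ f t₂ = v := by
  obtain ⟨a, hav, ha⟩ := ((hbot.eventually_ge_atTop v).and (eventually_le_atBot t₀)).exists
  obtain ⟨b, hbv, hb⟩ := ((htop.eventually_ge_atTop v).and (eventually_ge_atTop t₀)).exists
  obtain ⟨t₁, ht₁, h₁⟩ := intermediate_value_Icc' ha hf.continuousOn ⟨hv.le, hav⟩
  obtain ⟨t₂, ht₂, h₂⟩ := intermediate_value_Icc hb hf.continuousOn ⟨hv.le, hbv⟩
  refine ⟨t₁, t₂, lt_of_le_of_ne (ht₁.2.trans ht₂.1) ?_, h₁, h₂⟩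
  rintro rfl
  have : t₁ = t₀ := le_antisymm ht₁.2 ht₂.1
  subst this
  exact hv.ne h₁

lemma chi_neg_exp_div {c : ℝ} (hc : 0 < c) (k h t : ℝ) :
    chi k c h (-exp t / c) = exp t ^ 2 * (1 / c ^ 2 - zeroLevel k h t) := by
  have h1 : -(-exp t / c * c * h) = h * exp t := by
    field_simp
  have h2 := exp_pos t
  simp only [chi, zeroLevel, h1]
  field_simp
  ring

lemma neg_exp_log_div {c l : ℝ} (hc : 0 < c) (hl : l < 0) :
    -exp (log (-(l * c))) / c = l := by
  rw [exp_log (neg_pos.2 (mul_neg_of_neg_of_pos hl hc))]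
  field_simp

lemma chi_neg_exp_div_eq_zero_iff {c : ℝ} (hc : 0 < c) (k h t : ℝ) :
    chi k c h (-exp t / c) = 0 ↔ zeroLevel k h t = 1 / c ^ 2 := by
  rw [chi_neg_exp_div hc, mul_eq_zero, or_iff_right (by positivity), sub_eq_zero, eq_comm]

lemma neg_exp_div_neg {c : ℝ} (hc : 0 < c) (t : ℝ) : -exp t / c < 0 :=
  div_neg_of_neg_of_pos (neg_neg_of_pos (exp_pos t)) hc

/-- At the minimal level, `chi` has a local maximum with value zero. -/
lemma deriv_chi_eq_zero_of_forall_le {k c h t₀ : ℝ} (hc : 0 < c)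
    (hmin : ∀ t, zeroLevel k h t₀ ≤ zeroLevel k h t) (ht₀ : zeroLevel k h t₀ = 1 / c ^ 2) :
    deriv (chi k c h) (-exp t₀ / c) = 0 := by
  refine IsLocalMax.deriv_eq_zero ?_
  filter_upwards [eventually_lt_nhds (neg_exp_div_neg hc t₀)] with l hl
  rw [(chi_neg_exp_div_eq_zero_iff hc k h t₀).2 ht₀, ← neg_exp_log_div hc hl, chi_neg_exp_div hc]
  exact mul_nonpos_of_nonneg_of_nonpos (by positivity) (by linarith [hmin (log (-(l * c)))])

lemma exists_pos_chi_eq_zero {k c h : ℝ} (hk : k < 0) (hc : 0 < c) (hh : 0 < h) :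
    ∃ l, 0 < l ∧ chi k c h l = 0 := by
  have hcont : Continuous (chi k c h) := by
    unfold chi
    fun_prop
  have h0 : chi k c h 0 < 0 := by
    simp [chi]
    linarith
  have hb0 : (0 : ℝ) ≤ c + 1 - k := by linarith
  have hb : 0 ≤ chi k c h (c + 1 - k) := by
    have h1 : exp (-((c + 1 - k) * c * h)) ≤ 1 := by
      rw [exp_le_one_iff, neg_nonpos]
      positivity
    simp only [chi]
    nlinarith [mul_le_mul_of_nonpos_left h1 hk.le, mul_pos hc (neg_pos.2 hk)]
  obtain ⟨l, hl, hl0⟩ := intermediate_value_Icc hb0 hcont.continuousOn ⟨h0.le, hb⟩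
  refine ⟨l, lt_of_le_of_ne hl.1 ?_, hl0⟩
  rintro rfl
  exact h0.ne hl0

/-- The threshold `1 / √m` (or `⊤` when `m ≤ 0`) for the condition `m ≤ 1 / c ^ 2`. -/
lemma exists_ereal_le_iff_le_one_div_sq (m : ℝ) :
    ∃ s : EReal, 0 < s ∧ (∀ c : ℝ, 0 < c → ((c : EReal) ≤ s ↔ m ≤ 1 / c ^ 2)) ∧
      ∀ c : ℝ, 0 < c → (c : EReal) = s → m = 1 / c ^ 2 := by
  rcases le_or_gt m 0 with hm | hm
  · refine ⟨⊤, EReal.zero_lt_top, fun c _ => ?_, fun c _ h => absurd h (EReal.coe_ne_top c)⟩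
    simpa using hm.trans (by positivity)
  · have hs := sqrt_pos.2 hm
    refine ⟨((1 / √m : ℝ) : EReal), by exact_mod_cast one_div_pos.2 hs, fun c hc => ?_,
      fun c hc h => ?_⟩
    · rw [EReal.coe_le_coe_iff, le_one_div hc hs, ← one_div_pow, sqrt_le_left (by positivity)]
    · rw [EReal.coe_eq_coe_iff] at h
      rw [h, div_pow, sq_sqrt hm.le]
      simp

/-- for `k < 0`, `h > 0` there is a critical speed `c* ∈ (0,+∞]` such that
`χ(z) = z² − cz − 1 + k e^{−zch}` has three real zeros `λ₁ ≤ λ₂ < 0 < λ₃` iff `c ≤ c*`;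
at `c = c*` (if finite) there is a double negative zero, and for `c > c*` there are no
negative real zeros. -/
theorem stmt3 (k h : ℝ) (hk : k < 0) (hh : 0 < h) :
    ∃ cstar : EReal, 0 < cstar ∧
      (∀ c : ℝ, 0 < c →
        (((c : EReal) ≤ cstar) ↔
          ∃ l₁ l₂ l₃ : ℝ, l₁ ≤ l₂ ∧ l₂ < 0 ∧ 0 < l₃ ∧
            chi k c h l₁ = 0 ∧ chi k c h l₂ = 0 ∧ chi k c h l₃ = 0 ∧
            (l₁ = l₂ → deriv (chi k c h) l₁ = 0))) ∧
      (∀ c : ℝ, 0 < c → (c : EReal) = cstar →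
        ∃ l : ℝ, l < 0 ∧ chi k c h l = 0 ∧ deriv (chi k c h) l = 0) ∧
      (∀ c : ℝ, 0 < c → cstar < (c : EReal) →
        ∀ l : ℝ, l < 0 → chi k c h l ≠ 0) := by
  obtain ⟨t₀, hmin⟩ := exists_forall_zeroLevel_le hk hh
  obtain ⟨s, hs, hle, heq⟩ := exists_ereal_le_iff_le_one_div_sq (zeroLevel k h t₀)
  have level_le : ∀ c : ℝ, 0 < c → ∀ l < 0, chi k c h l = 0 → zeroLevel k h t₀ ≤ 1 / c ^ 2 := by
    intro c hc l hl h0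
    rw [← neg_exp_log_div hc hl, chi_neg_exp_div_eq_zero_iff hc] at h0
    exact h0 ▸ hmin _
  refine ⟨s, hs, fun c hc => ?_, fun c hc hcs => ?_, fun c hc hlt l hl h0 => ?_⟩
  · rw [hle c hc]
    refine ⟨fun hm => ?_, fun ⟨_, l₂, _, _, hl₂, _, _, h0, _⟩ => level_le c hc l₂ hl₂ h0⟩
    obtain ⟨l₃, hl₃, h₃⟩ := exists_pos_chi_eq_zero hk hc hh
    rcases hm.eq_or_lt with hm | hm
    · have h0 := (chi_neg_exp_div_eq_zero_iff hc k h t₀).2 hm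
      exact ⟨_, _, l₃, le_rfl, neg_exp_div_neg hc t₀, hl₃, h0, h0, h₃,
        fun _ => deriv_chi_eq_zero_of_forall_le hc hmin hm⟩
    · obtain ⟨t₁, t₂, ht, h₁, h₂⟩ := exists_lt_lt_of_tendsto_atTop (continuous_zeroLevel k h)
        (tendsto_zeroLevel_atBot hk h) (tendsto_zeroLevel_atTop hk hh) hm
      have hlt : -exp t₂ / c < -exp t₁ / c :=
        div_lt_div_of_pos_right (neg_lt_neg (exp_lt_exp.2 ht)) hc
      exact ⟨_, _, l₃, hlt.le, neg_exp_div_neg hc t₁, hl₃,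
        (chi_neg_exp_div_eq_zero_iff hc k h t₂).2 h₂,
        (chi_neg_exp_div_eq_zero_iff hc k h t₁).2 h₁, h₃, fun hl => absurd hl hlt.ne⟩
  · have hm := heq c hc hcs
    exact ⟨_, neg_exp_div_neg hc t₀, (chi_neg_exp_div_eq_zero_iff hc k h t₀).2 hm,
      deriv_chi_eq_zero_of_forall_le hc hmin hm⟩
  · exact hlt.not_ge ((hle c hc).2 (level_le c hc l hl h0))

end
end

section
/- Let k < 0, h > 0 and c ∈ (0, c*(h)], so that the characteristic function χ(z) = z² − cz − 1 + k e^{−zch} has real negative zeros λ₁ ≤ λ₂ < 0. Then every non-real complex zero λ of χ satisfies Re λ < λ₂ and |Im λ| > 2π/(ch). -/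
open Real Filter Set Topology

noncomputable section

/-- Characteristic function `z² − cz − 1 + k·e^{−zch}` (complex version). -/
def chiC (k c h : ℝ) : ℂ → ℂ :=
  fun z => z ^ 2 - (c : ℂ) * z - 1 + (k : ℂ) * Complex.exp (-(z * c * h))

/-- A closed form of `(u² + v²) ∫₀ᵗ (v - e^{-su} (v cos sv + u sin sv)) ds`, which is positive. -/
lemma damped_trig_integral_pos {u v t : ℝ} (hu : 0 ≤ u) (hv : 0 < v) (ht : 0 < t) :
    0 < v * t * (u ^ 2 + v ^ 2) - (v ^ 2 - u ^ 2) * (exp (-(t * u)) * sin (t * v))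
      + 2 * u * v * (exp (-(t * u)) * cos (t * v)) - 2 * u * v := by
  rcases hu.eq_or_lt with rfl | hu
  · have hsin := sin_lt (mul_pos ht hv)
    have : 0 < v ^ 2 * (t * v - sin (t * v)) := mul_pos (by positivity) (by linarith)
    simp only [mul_zero, neg_zero, exp_zero]
    linarith
  set H : ℝ → ℝ := fun s =>
    v * s * (u ^ 2 + v ^ 2) - (v ^ 2 - u ^ 2) * (exp (-(s * u)) * sin (s * v))
      + 2 * u * v * (exp (-(s * u)) * cos (s * v)) - 2 * u * v with hH
  have hderiv (s : ℝ) : HasDerivAt H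
      ((u ^ 2 + v ^ 2) * (v - exp (-(s * u)) * (v * cos (s * v) + u * sin (s * v)))) s := by
    have he : HasDerivAt (fun s : ℝ => exp (-(s * u))) (exp (-(s * u)) * (-(1 * u))) s :=
      ((hasDerivAt_id s).mul_const u).neg.exp
    have hs : HasDerivAt (fun s : ℝ => sin (s * v)) (cos (s * v) * (1 * v)) s :=
      ((hasDerivAt_id s).mul_const v).sin
    have hc : HasDerivAt (fun s : ℝ => cos (s * v)) (-sin (s * v) * (1 * v)) s :=
      ((hasDerivAt_id s).mul_const v).cos
    have hl : HasDerivAt (fun s : ℝ => v * s * (u ^ 2 + v ^ 2)) (v * 1 * (u ^ 2 + v ^ 2)) s :=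
      ((hasDerivAt_id s).const_mul v).mul_const _
    exact (((hl.sub ((he.mul hs).const_mul (v ^ 2 - u ^ 2))).add
      ((he.mul hc).const_mul (2 * u * v))).sub_const (2 * u * v)).congr_deriv (by ring)
  have hmono : StrictMonoOn H (Icc 0 t) := by
    refine strictMonoOn_of_deriv_pos (convex_Icc 0 t)
      (fun s _ => (hderiv s).continuousAt.continuousWithinAt) fun s hs => ?_
    rw [interior_Icc] at hs
    rw [(hderiv s).deriv]
    refine mul_pos (by positivity) ?_
    have hsin := sin_lt (mul_pos hs.1 hv)
    have hcos := cos_le_one (s * v)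
    have hexp : exp (-(s * u)) * (1 + s * u) ≤ 1 := by
      have := mul_le_mul_of_nonneg_left (add_one_le_exp (s * u)) (exp_pos (-(s * u))).le
      rw [← exp_add, neg_add_cancel, exp_zero] at this
      linarith
    have h₁ : v * cos (s * v) + u * sin (s * v) < v * (1 + s * u) := by
      nlinarith
    have h₂ := mul_lt_mul_of_pos_left h₁ (exp_pos (-(s * u)))
    nlinarith
  have := hmono (left_mem_Icc.2 ht.le) (right_mem_Icc.2 ht.le) ht
  simpa [hH] using this

/-- A closed form of `(T² + y²)² ∫₀¹ (1 - r) e^{-T(1-r)} sin (yr) dr`, which is positive for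
`y ∈ (0, π)`. -/
lemma weighted_sin_integral_pos (T : ℝ) {y : ℝ} (hy : 0 < y) (hyπ : y < π) :
    0 < y * exp (-T) * (T ^ 2 + y ^ 2 + 2 * T) + sin y * (T ^ 2 - y ^ 2)
      - 2 * T * y * cos y := by
  set G : ℝ → ℝ := fun r => exp (-(T * (1 - r))) *
    ((1 - r) * (T * sin (y * r) - y * cos (y * r)) * (T ^ 2 + y ^ 2)
      - sin (y * r) * (T ^ 2 + y ^ 2)
      + 2 * T * (T * sin (y * r) - y * cos (y * r))) with hG
  have hderiv (r : ℝ) : HasDerivAt G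
      ((T ^ 2 + y ^ 2) ^ 2 * ((1 - r) * exp (-(T * (1 - r))) * sin (y * r))) r := by
    have h1 : HasDerivAt (fun r : ℝ => 1 - r) (-1) r := (hasDerivAt_id r).const_sub 1
    have he : HasDerivAt (fun r : ℝ => exp (-(T * (1 - r))))
      (exp (-(T * (1 - r))) * (-(T * -1))) r := (h1.const_mul T).neg.exp
    have hs : HasDerivAt (fun r : ℝ => sin (y * r)) (cos (y * r) * (y * 1)) r :=
      ((hasDerivAt_id r).const_mul y).sin
    have hc : HasDerivAt (fun r : ℝ => cos (y * r)) (-sin (y * r) * (y * 1)) r :=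
      ((hasDerivAt_id r).const_mul y).cos
    have hsc := (hs.const_mul T).sub (hc.const_mul y)
    exact (he.mul ((((h1.mul hsc).mul_const (T ^ 2 + y ^ 2)).sub
      (hs.mul_const (T ^ 2 + y ^ 2))).add (hsc.const_mul (2 * T)))).congr_deriv (by
        simp only [Pi.sub_apply, Pi.mul_apply, Pi.add_apply]; ring)
  have hmono : StrictMonoOn G (Icc 0 1) := by
    refine strictMonoOn_of_deriv_pos (convex_Icc 0 1)
      (fun s _ => (hderiv s).continuousAt.continuousWithinAt) fun r hr => ?_
    rw [interior_Icc] at hr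
    rw [(hderiv r).deriv]
    have hsin : 0 < sin (y * r) :=
      sin_pos_of_pos_of_lt_pi (mul_pos hy hr.1) (by nlinarith [hr.2])
    have : 0 < 1 - r := sub_pos.2 hr.2
    positivity
  have := hmono (left_mem_Icc.2 zero_le_one) (right_mem_Icc.2 zero_le_one) zero_lt_one
  simp only [hG, sub_self, mul_zero, neg_zero, exp_zero, sin_zero, cos_zero, mul_one, sub_zero]
    at this
  linarith

lemma hasDerivAt_chi (k c h x : ℝ) :
    HasDerivAt (chi k c h) (2 * x - c - k * (c * h) * exp (-(x * c * h))) x := by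
  have he : HasDerivAt (fun x : ℝ => exp (-(x * c * h)))
      (exp (-(x * c * h)) * (-(1 * c * h))) x :=
    (((hasDerivAt_id x).mul_const c).mul_const h).neg.exp
  have hp : HasDerivAt (fun x : ℝ => x ^ 2 - c * x - 1) (2 * x - c) x :=
    ((((hasDerivAt_id x).pow 2).sub ((hasDerivAt_id x).const_mul c)).sub_const 1).congr_deriv
      (by simp)
  exact (hp.add (he.const_mul k)).congr_deriv (by ring)

/-- The derivative of `χ` is nonpositive at its largest negative zero. -/
lemma deriv_chi_nonpos_of_largest_neg_zero {k c h l : ℝ} (hk : k < 0) (hl : l < 0)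
    (hz : chi k c h l = 0) (hmax : ∀ x : ℝ, x < 0 → chi k c h x = 0 → x ≤ l) :
    deriv (chi k c h) l ≤ 0 := by
  by_contra! hpos
  have hd := (hasDerivAt_chi k c h l).differentiableAt.hasDerivAt
  have hev : ∀ᶠ x in 𝓝[>] l, 0 < slope (chi k c h) l x :=
    (hasDerivWithinAt_iff_tendsto_slope' (by simp)).1 (hd.hasDerivWithinAt (s := Ioi l))
      |>.eventually (lt_mem_nhds hpos)
  obtain ⟨x, hx, hlx, hx0⟩ := (hev.and (Ioo_mem_nhdsGT hl)).exists
  have hxpos : 0 < chi k c h x := by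
    rw [slope_def_field, hz, sub_zero] at hx
    exact (div_pos_iff_of_pos_right (sub_pos.2 hlx)).1 hx
  have h0 : chi k c h 0 < 0 := by simp [chi]; linarith
  have hcont : ContinuousOn (chi k c h) (Icc x 0) :=
    fun s _ => (hasDerivAt_chi k c h s).continuousAt.continuousWithinAt
  obtain ⟨w, ⟨hxw, hw0⟩, hw⟩ := intermediate_value_Ioo' hx0.le hcont ⟨h0, hxpos⟩
  linarith [hmax w hw0 hw]

/-- Real and imaginary parts of the equation `χ(z) = 0`. -/
lemma re_im_eq_of_chiC_eq_zero {k c h : ℝ} {z : ℂ} (hz : chiC k c h z = 0) :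
    z.re ^ 2 - z.im ^ 2 - c * z.re - 1
        + k * (exp (-(z.re * c * h)) * cos (c * h * z.im)) = 0 ∧
      z.im * (2 * z.re - c) - k * (exp (-(z.re * c * h)) * sin (c * h * z.im)) = 0 := by
  have hre := congrArg Complex.re hz
  have him := congrArg Complex.im hz
  simp only [chiC, Complex.add_re, Complex.sub_re, Complex.add_im, Complex.sub_im,
    Complex.mul_re, Complex.mul_im, Complex.exp_re, Complex.exp_im, Complex.neg_re,
    Complex.neg_im, Complex.ofReal_re, Complex.ofReal_im, Complex.one_re, Complex.one_im,
    Complex.zero_re, Complex.zero_im, pow_two, mul_zero, zero_mul, sub_zero, add_zero, zero_add,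
    cos_neg, sin_neg] at hre him
  rw [show z.im * c * h = c * h * z.im by ring] at hre him
  constructor <;> linarith

/-- A non-real zero `a + ib` lies strictly to the left of every real zero at which the
derivative of `χ` is nonpositive. -/
lemma re_lt_of_deriv_chi_nonpos {k c h l a b : ℝ} (hk : k < 0) (hc : 0 < c) (hh : 0 < h)
    (hz : chi k c h l = 0) (hd : deriv (chi k c h) l ≤ 0) (hb : 0 < b)
    (hre : a ^ 2 - b ^ 2 - c * a - 1 + k * (exp (-(a * c * h)) * cos (c * h * b)) = 0)
    (him : b * (2 * a - c) - k * (exp (-(a * c * h)) * sin (c * h * b)) = 0) :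
    a < l := by
  by_contra! hla
  have hpos := damped_trig_integral_pos (sub_nonneg.2 hla) hb (mul_pos hc hh)
  rw [(hasDerivAt_chi k c h l).deriv] at hd
  have hexp : exp (-(a * c * h)) = exp (-(l * c * h)) * exp (-(c * h * (a - l))) := by
    rw [← exp_add]; ring_nf
  simp only [chi] at hz
  rw [hexp] at hre him
  set M := exp (-(l * c * h))
  set E := exp (-(c * h * (a - l)))
  have hM : 0 < -k * M := mul_pos (neg_pos.2 hk) (exp_pos _)
  have hprod := mul_pos hM hpos
  have hle : b * ((a - l) ^ 2 + b ^ 2) * (2 * l - c - k * (c * h) * M) ≤ 0 :=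
    mul_nonpos_of_nonneg_of_nonpos (by positivity) hd
  refine hprod.not_ge (le_of_eq_of_le ?_ hle)
  linear_combination (-(b ^ 2 - (a - l) ^ 2)) * him - 2 * (a - l) * b * hre
    + 2 * (a - l) * b * hz

/-- If `χ` has a zero `a + ib` with `0 < chb < π`, then the Wronskian of `χ` and
`(x - a)² + b²` is positive on the real line. -/
lemma wronskian_chi_pos {k c h a b : ℝ} (hk : k < 0) (hc : 0 < c) (hh : 0 < h) (hb : 0 < b)
    (hbπ : c * h * b < π)
    (hre : a ^ 2 - b ^ 2 - c * a - 1 + k * (exp (-(a * c * h)) * cos (c * h * b)) = 0)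
    (him : b * (2 * a - c) - k * (exp (-(a * c * h)) * sin (c * h * b)) = 0) (x : ℝ) :
    0 < deriv (chi k c h) x * ((x - a) ^ 2 + b ^ 2) - chi k c h x * (2 * (x - a)) := by
  have hτ := mul_pos hc hh
  have hpos := weighted_sin_integral_pos (c * h * (x - a)) (mul_pos hτ hb) hbπ
  rw [(hasDerivAt_chi k c h x).deriv]
  have hexp : exp (-(x * c * h)) = exp (-(a * c * h)) * exp (-(c * h * (x - a))) := by
    rw [← exp_add]; ring_nf
  simp only [chi]
  rw [hexp]
  set M := exp (-(a * c * h))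
  set E := exp (-(c * h * (x - a)))
  have hM : 0 < -k * M := mul_pos (neg_pos.2 hk) (exp_pos _)
  have hscale : 0 < (c * h) ^ 2 * b := by positivity
  refine (mul_pos_iff_of_pos_left hscale).1 ((mul_pos hM hpos).trans_eq ?_)
  linear_combination (c * h) ^ 2 * ((x - a) ^ 2 - b ^ 2) * him
    + 2 * (c * h) ^ 2 * (x - a) * b * hre

/-- If `χ` has two real zeros, counted with multiplicity, then it has no non-real zero
`a + ib` with `0 < chb < π`. -/
lemma pi_le_of_two_real_zeros {k c h l₁ l₂ a b : ℝ} (hk : k < 0) (hc : 0 < c) (hh : 0 < h)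
    (hle : l₁ ≤ l₂) (hz₁ : chi k c h l₁ = 0) (hz₂ : chi k c h l₂ = 0)
    (hdbl : l₁ = l₂ → deriv (chi k c h) l₂ = 0) (hb : 0 < b)
    (hre : a ^ 2 - b ^ 2 - c * a - 1 + k * (exp (-(a * c * h)) * cos (c * h * b)) = 0)
    (him : b * (2 * a - c) - k * (exp (-(a * c * h)) * sin (c * h * b)) = 0) :
    π ≤ c * h * b := by
  by_contra! hbπ
  have hW := wronskian_chi_pos hk hc hh hb hbπ hre him
  rcases hle.eq_or_lt with heq | hlt
  · have := hW l₂
    rw [hdbl heq, hz₂] at this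
    simp at this
  have hq (x : ℝ) : (x - a) ^ 2 + b ^ 2 ≠ 0 := by positivity
  have hderiv (x : ℝ) : HasDerivAt (fun x => chi k c h x / ((x - a) ^ 2 + b ^ 2))
      ((deriv (chi k c h) x * ((x - a) ^ 2 + b ^ 2) - chi k c h x * (2 * (x - a)))
        / ((x - a) ^ 2 + b ^ 2) ^ 2) x := by
    have hquad : HasDerivAt (fun x : ℝ => (x - a) ^ 2 + b ^ 2) (2 * (x - a)) x :=
      ((((hasDerivAt_id x).sub_const a).pow 2).add_const (b ^ 2)).congr_deriv (by simp)
    exact (hasDerivAt_chi k c h x).differentiableAt.hasDerivAt.div hquad (hq x)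
  obtain ⟨x, -, hx⟩ := exists_hasDerivAt_eq_zero hlt
    (fun x _ => (hderiv x).continuousAt.continuousWithinAt) (by simp [hz₁, hz₂])
    (fun x _ => hderiv x)
  exact (div_pos (hW x) (by positivity)).ne' hx

/-- if `χ` has negative real zeros `λ₁ ≤ λ₂ < 0` (with `λ₂` the larger
negative real zero), then every non-real complex zero `λ` of `χ` satisfies
`Re λ < λ₂` and `|Im λ| > 2π/(ch)`. -/
theorem stmt4 (k c h l₁ l₂ : ℝ) (hk : k < 0) (hc : 0 < c) (hh : 0 < h)
    (hle : l₁ ≤ l₂) (hneg : l₂ < 0)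
    (hz₁ : chi k c h l₁ = 0) (hz₂ : chi k c h l₂ = 0)
    (hdbl : l₁ = l₂ → deriv (chi k c h) l₂ = 0)
    (hmax : ∀ x : ℝ, x < 0 → chi k c h x = 0 → x ≤ l₂) :
    ∀ z : ℂ, chiC k c h z = 0 → z.im ≠ 0 →
      z.re < l₂ ∧ 2 * Real.pi / (c * h) < |z.im| := by
  intro z hz hzim
  obtain ⟨hre, him⟩ := re_im_eq_of_chiC_eq_zero hz
  have hb : 0 < |z.im| := abs_pos.2 hzim
  have hτ := mul_pos hc hh
  obtain ⟨hre, him⟩ : z.re ^ 2 - |z.im| ^ 2 - c * z.re - 1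
        + k * (exp (-(z.re * c * h)) * cos (c * h * |z.im|)) = 0 ∧
      |z.im| * (2 * z.re - c) - k * (exp (-(z.re * c * h)) * sin (c * h * |z.im|)) = 0 := by
    rcases abs_choice z.im with habs | habs <;> rw [habs]
    · exact ⟨hre, him⟩
    · rw [mul_neg, cos_neg, sin_neg]
      constructor <;> linarith
  have hlt : z.re < l₂ := re_lt_of_deriv_chi_nonpos hk hc hh hz₂
    (deriv_chi_nonpos_of_largest_neg_zero hk hneg hz₂ hmax) hb hre him
  refine ⟨hlt, ?_⟩
  rw [div_lt_iff₀' hτ]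
  by_contra! hle2π
  have hπ := pi_le_of_two_real_zeros hk hc hh hle hz₁ hz₂ hdbl hb hre him
  have hsin : sin (c * h * |z.im|) ≤ 0 := by
    have := sin_nonneg_of_nonneg_of_le_pi (sub_nonneg.2 hπ) (by linarith)
    rw [sin_sub_pi] at this
    linarith
  have h₁ : 0 ≤ k * (exp (-(z.re * c * h)) * sin (c * h * |z.im|)) :=
    mul_nonneg_of_nonpos_of_nonpos hk.le
      (mul_nonpos_of_nonneg_of_nonpos (exp_pos _).le hsin)
  have h₂ : |z.im| * (2 * z.re - c) < 0 := mul_neg_of_pos_of_neg hb (by linarith)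
  linarith

end
end

section
/- Assume g satisfies hypotheses (UM) and (GA) for given c > 0 and h ≥ 0. Then every semi-wavefront profile φ with speed c converges to κ at +∞: lim_{t→+∞} φ(t) = κ. -/
open Real Filter Set Topology

noncomputable section

/-- The negative root `z₁` of `z² − cz − 1 = 0`. -/
def zneg (c : ℝ) : ℝ := (c - Real.sqrt (c ^ 2 + 4)) / 2

/-- The positive root `z₂` of `z² − cz − 1 = 0`. -/
def zpos (c : ℝ) : ℝ := (c + Real.sqrt (c ^ 2 + 4)) / 2

/-- `ξ(h,c) = (z₂ − z₁)/(z₂ e^{−chz₁} − z₁ e^{−chz₂})`. -/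
def xi (c h : ℝ) : ℝ :=
  (zpos c - zneg c) /
    (zpos c * Real.exp (-(c * h * zneg c)) - zneg c * Real.exp (-(c * h * zpos c)))

/-- `κ` is a globally attracting fixed point of `f` on the (invariant) set `I`. -/
def GloballyAttracting (f : ℝ → ℝ) (I : Set ℝ) (κ : ℝ) : Prop :=
  MapsTo f I I ∧ κ ∈ I ∧ f κ = κ ∧
    ∀ x ∈ I, Tendsto (fun n => f^[n] x) atTop (𝓝 κ)

/-- Hypothesis (GA): with `ψ` the inverse of `g` restricted to `[θ₁, g(θ)]`,
`ζ(x) = x − ψ(x)` and `σ` satisfying `ζ(σ(x)) = (1 − ξ)g(x)`, the point `κ` is a globally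
attracting fixed point of `g` or of `σ` on `[g²(θ), g(θ)]`. -/
def GAHyp (g : ℝ → ℝ) (θ θ₁ κ c h : ℝ) : Prop :=
  θ ≤ θ₁ ∧ θ₁ < κ ∧
  StrictAntiOn g (Icc θ₁ (g θ)) ∧
  Icc (g (g θ)) (g θ) ⊆ g '' Icc θ₁ (g θ) ∧
  ∃ ψ σ : ℝ → ℝ,
    (∀ x ∈ Icc (g (g θ)) (g θ), ψ x ∈ Icc θ₁ (g θ) ∧ g (ψ x) = x) ∧
    (∀ x ∈ Icc (g (g θ)) (g θ),
        σ x ∈ Icc (g (g θ)) (g θ) ∧ σ x - ψ (σ x) = (1 - xi c h) * g x) ∧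
    (GloballyAttracting g (Icc (g (g θ)) (g θ)) κ ∨
      GloballyAttracting σ (Icc (g (g θ)) (g θ)) κ)

/-- A semi-wavefront profile with speed `c`: a positive bounded `C²` solution of the
profile equation with `φ(−∞) = 0`. -/
structure SemiWavefront (g : ℝ → ℝ) (c h : ℝ) (φ : ℝ → ℝ) : Prop where
  smooth : ContDiff ℝ 2 φ
  pos : ∀ t, 0 < φ t
  bdd : ∃ M : ℝ, ∀ t, φ t ≤ M
  eqn : ∀ t, deriv (deriv φ) t - c * deriv φ t - φ t + g (φ (t - c * h)) = 0
  lim_bot : Tendsto φ atBot (𝓝 0)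

/-- A function with negative derivative at `t` exceeds its value at `t` just to the left. -/
lemma eventually_left_gt_of_deriv_neg {u : ℝ → ℝ} {a t : ℝ} (hu : HasDerivAt u a t) (ha : a < 0) :
    ∀ᶠ s in 𝓝[<] t, u t < u s := by
  have h := (hasDerivWithinAt_iff_tendsto_slope' (s := Iio t) (by simp)).1 hu.hasDerivWithinAt
  filter_upwards [h.eventually (gt_mem_nhds ha), self_mem_nhdsWithin] with s hs hst
  rw [slope_def_field, div_lt_iff_of_neg (sub_neg.2 hst)] at hs
  linarith

/-- A differentiable function which attains at `t` its maximum over `[r, t]` has nonnegative slope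
there. -/
lemma deriv_nonneg_of_isMaxOn_left {u : ℝ → ℝ} {a r t : ℝ} (hu : HasDerivAt u a t) (hrt : r < t)
    (hmax : ∀ s ∈ Icc r t, u s ≤ u t) : 0 ≤ a := by
  by_contra! ha
  have h2 : ∀ᶠ s in 𝓝[<] t, r < s := nhdsWithin_le_nhds (lt_mem_nhds hrt)
  obtain ⟨s, hs, hrs, hst⟩ :=
    ((eventually_left_gt_of_deriv_neg hu ha).and (h2.and self_mem_nhdsWithin)).exists
  exact (hmax s ⟨hrs.le, le_of_lt hst⟩).not_gt hs

/-- A nonnegative first and a positive second derivative force growth to the right. -/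
lemma exists_gt_of_deriv_nonneg {u u' : ℝ → ℝ} {b t r : ℝ} (hu : ∀ t, HasDerivAt u (u' t) t)
    (hu' : HasDerivAt u' b t) (h0 : 0 ≤ u' t) (hb : 0 < b) (htr : t < r) :
    ∃ s ∈ Ioc t r, u t < u s := by
  have h := (hasDerivWithinAt_iff_tendsto_slope' (s := Ioi t) (by simp)).1 hu'.hasDerivWithinAt
  have hpos : ∀ᶠ s in 𝓝[>] t, 0 < u' s := by
    filter_upwards [h.eventually (lt_mem_nhds hb), self_mem_nhdsWithin] with s hs hst
    rw [slope_def_field, lt_div_iff₀ (sub_pos.2 hst)] at hs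
    linarith
  obtain ⟨q, hq, hsub⟩ := (mem_nhdsGT_iff_exists_Ioc_subset).1 hpos
  have hq : t < q := hq
  refine ⟨min q r, ⟨lt_min hq htr, min_le_right _ _⟩, ?_⟩
  refine strictMonoOn_of_deriv_pos (convex_Icc t (min q r))
    (fun x _ => (hu x).continuousAt.continuousWithinAt) (fun x hx => ?_)
    (left_mem_Icc.2 (lt_min hq htr).le) (right_mem_Icc.2 (lt_min hq htr).le) (lt_min hq htr)
  rw [interior_Icc] at hx
  rw [(hu x).deriv]
  exact hsub ⟨hx.1, hx.2.le.trans (min_le_left _ _)⟩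

/-- If `u'' > c u'` at every running maximum of `u` on `[t₀, ∞)` and `u' t₀ ≥ 0`, then `u` is
unbounded above. -/
lemma false_of_bddAbove_of_running_max {u u' u'' : ℝ → ℝ} {c t₀ B : ℝ}
    (hu : ∀ t, HasDerivAt u (u' t) t) (hu' : ∀ t, HasDerivAt u' (u'' t) t) (hc : 0 < c)
    (hB : ∀ t, u t ≤ B) (h0 : 0 ≤ u' t₀)
    (hrec : ∀ t, t₀ ≤ t → (∀ s ∈ Icc t₀ t, u s ≤ u t) → c * u' t < u'' t) : False := by
  have hmax : ∀ t, t₀ ≤ t → ∀ s ∈ Icc t₀ t, u s ≤ u t := by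
    intro t ht
    obtain ⟨τ, hτ, hτmax⟩ := isCompact_Icc.exists_isMaxOn (nonempty_Icc.2 ht)
      (fun x _ => (hu x).continuousAt.continuousWithinAt : ContinuousOn u (Icc t₀ t))
    rcases hτ.2.eq_or_lt with rfl | hlt
    · exact fun s hs => hτmax hs
    have hτrec : ∀ s ∈ Icc t₀ τ, u s ≤ u τ := fun s hs => hτmax ⟨hs.1, hs.2.trans hτ.2⟩
    have hτ' : 0 ≤ u' τ := by
      rcases hτ.1.eq_or_lt with rfl | hlt'
      · exact h0
      · exact deriv_nonneg_of_isMaxOn_left (hu τ) hlt' hτrec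
    obtain ⟨s, hs, hus⟩ := exists_gt_of_deriv_nonneg hu (hu' τ) hτ'
      ((mul_nonneg hc.le hτ').trans_lt (hrec τ hτ.1 hτrec)) hlt
    exact absurd (hτmax ⟨hτ.1.trans hs.1.le, hs.2⟩) (not_le.2 hus)
  have hnn : ∀ t, t₀ ≤ t → 0 ≤ u' t := by
    intro t ht
    rcases ht.eq_or_lt with rfl | hlt
    · exact h0
    · exact deriv_nonneg_of_isMaxOn_left (hu t) hlt (hmax t ht)
  have hmono : StrictMonoOn u' (Ici t₀) := by
    refine strictMonoOn_of_deriv_pos (convex_Ici t₀)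
      (fun x _ => (hu' x).continuousAt.continuousWithinAt) (fun x hx => ?_)
    rw [interior_Ici] at hx
    rw [(hu' x).deriv]
    exact (mul_nonneg hc.le (hnn x (le_of_lt hx))).trans_lt
      (hrec x (le_of_lt hx) (hmax x (le_of_lt hx)))
  have hb : 0 < u' (t₀ + 1) :=
    h0.trans_lt (hmono self_mem_Ici (by simp) (by linarith))
  set r := (B - u (t₀ + 1)) / u' (t₀ + 1) + 1 with hr
  have hr1 : 1 ≤ r := by
    have : 0 ≤ (B - u (t₀ + 1)) / u' (t₀ + 1) := div_nonneg (by linarith [hB (t₀ + 1)]) hb.le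
    linarith
  have key := (convex_Ici (t₀ + 1)).mul_sub_le_image_sub_of_le_deriv (f := u)
    (C := u' (t₀ + 1))
    (fun x _ => (hu x).continuousAt.continuousWithinAt)
    (fun x _ => (hu x).differentiableAt.differentiableWithinAt)
    (fun x hx => by
      rw [interior_Ici] at hx
      rw [(hu x).deriv]
      have hx : t₀ + 1 < x := hx
      exact (hmono (by simp) (by simp; linarith) hx).le)
    (t₀ + 1) self_mem_Ici (t₀ + 1 + r) (by simp; linarith) (by linarith)
  have : u' (t₀ + 1) * (t₀ + 1 + r - (t₀ + 1)) = B - u (t₀ + 1) + u' (t₀ + 1) := by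
    rw [hr]; field_simp; ring
  linarith [hB (t₀ + 1 + r)]

/-- A bounded function which frequently exceeds `L` cannot eventually satisfy
`u'' - c u' ≥ ε > 0` wherever it exceeds `L`. -/
lemma frequently_gt_and_lt {u u' u'' : ℝ → ℝ} {c B L ε : ℝ}
    (hu : ∀ t, HasDerivAt u (u' t) t) (hu' : ∀ t, HasDerivAt u' (u'' t) t) (hc : 0 < c)
    (hB : ∀ t, |u t| ≤ B) (hε : 0 < ε) (hL : ∃ᶠ t in atTop, L < u t) :
    ∃ᶠ t in atTop, L < u t ∧ u'' t - c * u' t < ε := by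
  by_contra hcon
  rw [not_frequently, eventually_atTop] at hcon
  obtain ⟨T, hT⟩ := hcon
  replace hT : ∀ t, T ≤ t → L < u t → ε ≤ u'' t - c * u' t := fun t ht hLt => by
    by_contra! hlt
    exact hT t ht ⟨hLt, hlt⟩
  have hneg : ∀ t, T ≤ t → L < u t → u' t < 0 := by
    intro t ht hLt
    by_contra! h0
    refine false_of_bddAbove_of_running_max hu hu' hc (fun s => (le_abs_self _).trans (hB s)) h0
      (fun s hs hrec => ?_)
    linarith [hT s (ht.trans hs) (hLt.trans_le (hrec t ⟨le_rfl, hs⟩))]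
  have hgt : ∀ t, T ≤ t → L < u t := by
    intro t ht
    by_contra! hle
    obtain ⟨r, hr, hLr⟩ := frequently_atTop.1 hL t
    obtain ⟨τ, hτ, hτmax⟩ := isCompact_Icc.exists_isMaxOn (nonempty_Icc.2 hr)
      (fun x _ => (hu x).continuousAt.continuousWithinAt : ContinuousOn u (Icc t r))
    have hLτ : L < u τ := lt_of_lt_of_le hLr (hτmax ⟨hr, le_rfl⟩)
    have htτ : t < τ := lt_of_le_of_ne hτ.1 (by rintro rfl; exact hle.not_gt hLτ)
    exact (hneg τ (ht.trans hτ.1) hLτ).not_ge (deriv_nonneg_of_isMaxOn_left (hu τ) htτ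
      fun s hs => hτmax ⟨hs.1, hs.2.trans hτ.2⟩)
  have hv : ∀ t, HasDerivAt (fun s => u' s - c * u s) (u'' t - c * u' t) t :=
    fun t => (hu' t).sub ((hu t).const_mul c)
  set r := (|u' T| + 2 * c * B) / ε + 1 with hr
  have hB0 : 0 ≤ B := (abs_nonneg _).trans (hB T)
  have hr0 : 0 ≤ r := by positivity
  have key := (convex_Ici T).mul_sub_le_image_sub_of_le_deriv (f := fun s => u' s - c * u s)
    (C := ε)
    (fun x _ => (hv x).continuousAt.continuousWithinAt)
    (fun x _ => (hv x).differentiableAt.differentiableWithinAt)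
    (fun x hx => by
      rw [interior_Ici] at hx
      rw [(hv x).deriv]
      exact hT x (le_of_lt hx) (hgt x (le_of_lt hx)))
    T self_mem_Ici (T + r) (by simp; linarith) (by linarith)
  have h1 : ε * (T + r - T) = |u' T| + 2 * c * B + ε := by
    rw [hr]; field_simp; ring
  have h2 := hneg (T + r) (by linarith) (hgt _ (by linarith))
  have h3 := mul_le_mul_of_nonneg_left (abs_le.1 (hB T)).2 hc.le
  have h4 := mul_le_mul_of_nonneg_left (abs_le.1 (hB (T + r))).1 hc.le
  have h5 := neg_abs_le (u' T)
  linarith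

/-- Fluctuation lemma: a bounded solution of `u'' - c u' = u - G` has, along some sequence tending
to infinity, values at least (asymptotically) `L` which do not exceed those of `G`. -/
lemma exists_seq_fluctuation {u u' u'' G : ℝ → ℝ} {c B L : ℝ}
    (hu : ∀ t, HasDerivAt u (u' t) t) (hu' : ∀ t, HasDerivAt u' (u'' t) t) (hc : 0 < c)
    (hB : ∀ t, |u t| ≤ B) (heq : ∀ t, u'' t - c * u' t = u t - G t)
    (hL : ∀ ε > 0, ∃ᶠ t in atTop, L - ε < u t) :
    ∃ t : ℕ → ℝ, Tendsto t atTop atTop ∧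
      ∀ n : ℕ, L - 1 / ((n : ℝ) + 1) < u (t n) ∧ u (t n) < G (t n) + 1 / ((n : ℝ) + 1) := by
  have h : ∀ n : ℕ, ∃ t : ℝ, (n : ℝ) ≤ t ∧ L - 1 / ((n : ℝ) + 1) < u t ∧
      u t < G t + 1 / ((n : ℝ) + 1) := by
    intro n
    have hn : (0 : ℝ) < 1 / ((n : ℝ) + 1) := by positivity
    obtain ⟨t, ht, h1, h2⟩ :=
      frequently_atTop.1 (frequently_gt_and_lt hu hu' hc hB hn (hL _ hn)) n
    rw [heq] at h2
    exact ⟨t, ht, h1, by linarith⟩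
  choose t ht h1 using h
  exact ⟨t, tendsto_atTop_mono ht tendsto_natCast_atTop_atTop, h1⟩

/-- Persistence: a positive function with `u'' < c u'` at all small values not exceeding the
value at time lag `d` stays away from zero. -/
lemma exists_pos_eventually_le {u u' u'' : ℝ → ℝ} {c d η T : ℝ}
    (hu : ∀ t, HasDerivAt u (u' t) t) (hu' : ∀ t, HasDerivAt u' (u'' t) t) (hc : 0 < c)
    (hd : 0 ≤ d) (hη : 0 < η) (hpos : ∀ t, 0 < u t)
    (hT : ∀ t, T ≤ t → u t < η → u t ≤ u (t - d) → u'' t < c * u' t) :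
    ∃ ε > 0, ∀ᶠ t in atTop, ε ≤ u t := by
  have hcont : Continuous u := continuous_iff_continuousAt.2 fun t => (hu t).continuousAt
  obtain ⟨a, -, hamin⟩ := isCompact_Icc.exists_isMinOn
    (nonempty_Icc.2 (le_add_of_nonneg_right hd : T ≤ T + d)) hcont.continuousOn
  refine ⟨min (u a) η, lt_min (hpos a) hη, eventually_atTop.2 ⟨T + d, fun r hr => ?_⟩⟩
  by_contra! hlt
  obtain ⟨τ, hτ, hτmin⟩ := isCompact_Icc.exists_isMinOn
    (nonempty_Icc.2 ((le_add_of_nonneg_right hd).trans hr : T ≤ r)) hcont.continuousOn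
  have hτr : u τ ≤ u r := hτmin ⟨(le_add_of_nonneg_right hd).trans hr, le_rfl⟩
  have hτη : u τ < η := hτr.trans_lt (hlt.trans_le (min_le_right _ _))
  have hTτ : T + d < τ := by
    by_contra! hle
    exact (hτr.trans_lt (hlt.trans_le (min_le_left _ _))).not_ge (hamin ⟨hτ.1, hle⟩)
  refine false_of_bddAbove_of_running_max (u := fun t => -u t) (u' := fun t => -u' t)
    (u'' := fun t => -u'' t) (t₀ := τ) (B := 0) (fun t => (hu t).neg) (fun t => (hu' t).neg) hc
    (fun t => by linarith [hpos t]) ?_ ?_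
  · exact deriv_nonneg_of_isMaxOn_left (hu τ).neg ((le_add_of_nonneg_right hd).trans_lt hTτ)
      fun s hs => neg_le_neg (hτmin ⟨hs.1, hs.2.trans hτ.2⟩)
  · intro t ht hrec
    have hle : u t ≤ u τ := neg_le_neg_iff.1 (hrec τ ⟨le_rfl, ht⟩)
    have hlag : u t ≤ u (t - d) := by
      rcases le_total τ (t - d) with h | h
      · exact neg_le_neg_iff.1 (hrec (t - d) ⟨h, by linarith⟩)
      · exact hle.trans (hτmin ⟨by linarith, h.trans hτ.2⟩)
    have := hT t (by linarith) (hle.trans_lt hτη) hlag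
    linarith

lemma SemiWavefront.hasDerivAt {g φ : ℝ → ℝ} {c h : ℝ} (hφ : SemiWavefront g c h φ) (t : ℝ) :
    HasDerivAt φ (deriv φ t) t :=
  (hφ.smooth.differentiable (by norm_num) t).hasDerivAt

lemma SemiWavefront.hasDerivAt_deriv {g φ : ℝ → ℝ} {c h : ℝ} (hφ : SemiWavefront g c h φ)
    (t : ℝ) : HasDerivAt (deriv φ) (deriv (deriv φ) t) t :=
  ((hφ.smooth.differentiable_deriv_two) t).hasDerivAt

lemma exists_subseq_tendsto_mem_Icc {φ : ℝ → ℝ} {m M B d : ℝ} (hB : ∀ t, |φ t| ≤ B)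
    (hm : ∀ ε > 0, ∀ᶠ t in atTop, m - ε < φ t) (hM : ∀ ε > 0, ∀ᶠ t in atTop, φ t < M + ε)
    {t : ℕ → ℝ} (ht : Tendsto t atTop atTop) :
    ∃ p ∈ Icc m M, ∃ k : ℕ → ℕ, StrictMono k ∧ Tendsto (fun n => φ (t (k n) - d)) atTop (𝓝 p) := by
  obtain ⟨p, -, k, hk, hp⟩ := tendsto_subseq_of_bounded (Metric.isBounded_Icc (-B) B)
    (x := fun n => φ (t n - d)) (fun n => abs_le.1 (hB _))
  have hsub : Tendsto (fun n => t (k n) - d) atTop atTop :=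
    tendsto_atTop_add_const_right _ (-d) (ht.comp hk.tendsto_atTop)
  refine ⟨p, ⟨le_of_forall_pos_le_add fun ε hε => ?_, le_of_forall_pos_le_add fun ε hε => ?_⟩,
    k, hk, hp⟩
  · have := ge_of_tendsto hp ((hsub.eventually (hm ε hε)).mono fun n hn => le_of_lt hn)
    linarith
  · exact le_of_tendsto hp ((hsub.eventually (hM ε hε)).mono fun n hn => le_of_lt hn)

lemma tendsto_one_div_comp {k : ℕ → ℕ} (hk : StrictMono k) :
    Tendsto (fun n => 1 / ((k n : ℝ) + 1)) atTop (𝓝 0) :=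
  tendsto_one_div_add_atTop_nhds_zero_nat.comp hk.tendsto_atTop

section Fluctuation

variable {g φ : ℝ → ℝ} {c h m M B : ℝ}

/-- The upper limit `M` of a semi-wavefront satisfies `M ≤ g p` for some `p` between the lower and
the upper limit. -/
lemma SemiWavefront.upper_limit_le (hg : ContinuousOn g (Ici 0)) (hφ : SemiWavefront g c h φ)
    (hc : 0 < c) (hB : ∀ t, |φ t| ≤ B) (hm0 : 0 ≤ m)
    (hm : ∀ ε > 0, ∀ᶠ t in atTop, m - ε < φ t) (hM : ∀ ε > 0, ∀ᶠ t in atTop, φ t < M + ε)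
    (hMf : ∀ ε > 0, ∃ᶠ t in atTop, M - ε < φ t) :
    ∃ p ∈ Icc m M, M ≤ g p ∧ (h = 0 → p = M) := by
  obtain ⟨t, ht, hseq⟩ := exists_seq_fluctuation (G := fun t => g (φ (t - c * h)))
    hφ.hasDerivAt hφ.hasDerivAt_deriv hc hB (fun t => by linarith [hφ.eqn t]) hMf
  obtain ⟨p, hp, k, hk, hlim⟩ := exists_subseq_tendsto_mem_Icc (d := c * h) hB hm hM ht
  have h0 := tendsto_one_div_comp hk
  have hgp : Tendsto (fun n => g (φ (t (k n) - c * h))) atTop (𝓝 (g p)) :=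
    (hg p (hm0.trans hp.1)).tendsto.comp (tendsto_nhdsWithin_iff.2
      ⟨hlim, Eventually.of_forall fun n => (hφ.pos _).le⟩)
  refine ⟨p, hp, ?_, ?_⟩
  · have := le_of_tendsto_of_tendsto' (tendsto_const_nhds.sub h0) (hgp.add h0)
      fun n => ((hseq (k n)).1.trans (hseq (k n)).2).le
    simpa using this
  · rintro rfl
    refine le_antisymm hp.2 ?_
    have := le_of_tendsto_of_tendsto' (tendsto_const_nhds.sub h0) hlim
      fun n => by simpa using (hseq (k n)).1.le
    simpa using this

/-- The lower limit `m` of a semi-wavefront satisfies `g q ≤ m` for some `q` between the lower and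
the upper limit. -/
lemma SemiWavefront.le_lower_limit (hg : ContinuousOn g (Ici 0)) (hφ : SemiWavefront g c h φ)
    (hc : 0 < c) (hB : ∀ t, |φ t| ≤ B) (hm0 : 0 ≤ m)
    (hm : ∀ ε > 0, ∀ᶠ t in atTop, m - ε < φ t) (hM : ∀ ε > 0, ∀ᶠ t in atTop, φ t < M + ε)
    (hmf : ∀ ε > 0, ∃ᶠ t in atTop, φ t < m + ε) :
    ∃ q ∈ Icc m M, g q ≤ m ∧ (h = 0 → q = m) := by
  obtain ⟨t, ht, hseq⟩ := exists_seq_fluctuation (u := fun t => -φ t) (u' := fun t => -deriv φ t)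
    (u'' := fun t => -deriv (deriv φ) t) (G := fun t => -g (φ (t - c * h))) (L := -m)
    (fun t => (hφ.hasDerivAt t).neg) (fun t => (hφ.hasDerivAt_deriv t).neg) hc
    (fun t => by rw [abs_neg]; exact hB t) (fun t => by linarith [hφ.eqn t])
    (fun ε hε => (hmf ε hε).mono fun t ht => by linarith)
  obtain ⟨q, hq, k, hk, hlim⟩ := exists_subseq_tendsto_mem_Icc (d := c * h) hB hm hM ht
  have h0 := tendsto_one_div_comp hk
  have hgq : Tendsto (fun n => g (φ (t (k n) - c * h))) atTop (𝓝 (g q)) :=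
    (hg q (hm0.trans hq.1)).tendsto.comp (tendsto_nhdsWithin_iff.2
      ⟨hlim, Eventually.of_forall fun n => (hφ.pos _).le⟩)
  refine ⟨q, hq, ?_, ?_⟩
  · have := le_of_tendsto_of_tendsto' (hgq.sub h0) (tendsto_const_nhds.add h0)
      fun n => show _ ≤ m + _ by linarith [(hseq (k n)).1.trans (hseq (k n)).2]
    simpa using this
  · rintro rfl
    refine le_antisymm ?_ hq.1
    have := le_of_tendsto_of_tendsto' hlim (tendsto_const_nhds.add h0)
      fun n => show _ ≤ m + _ by
        rw [mul_zero, sub_zero]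
        linarith [(hseq (k n)).1]
    simpa using this

/-- A semi-wavefront is bounded away from zero at `+∞` as soon as `g` pushes small values up. -/
lemma SemiWavefront.persistent {η : ℝ} (hφ : SemiWavefront g c h φ) (hc : 0 < c) (hh : 0 ≤ h)
    (hη : 0 < η)
    (hpush : ∀ᶠ t in atTop, φ t < η → φ t ≤ φ (t - c * h) → φ t < g (φ (t - c * h))) :
    ∃ ε > 0, ∀ᶠ t in atTop, ε ≤ φ t := by
  obtain ⟨T, hT⟩ := eventually_atTop.1 hpush
  refine exists_pos_eventually_le (T := T) hφ.hasDerivAt hφ.hasDerivAt_deriv hc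
    (mul_nonneg hc.le hh) hη hφ.pos fun t ht h1 h2 => ?_
  linarith [hT t ht h1 h2, hφ.eqn t]

end Fluctuation

/-- `ξ(h, c) = 1` only without delay. -/
lemma eq_zero_of_xi_eq_one {c h : ℝ} (hc : 0 < c) (hxi : xi c h = 1) : h = 0 := by
  by_contra hne
  have hs : c ^ 2 < √(c ^ 2 + 4) ^ 2 := by rw [Real.sq_sqrt (by positivity)]; linarith
  have hcs : c < √(c ^ 2 + 4) := lt_of_pow_lt_pow_left₀ 2 (Real.sqrt_nonneg _) hs
  have h2 : 0 < zpos c := by unfold zpos; linarith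
  have h1 : zneg c < 0 := by unfold zneg; linarith
  have e1 : -(c * h * zneg c) + 1 < rexp (-(c * h * zneg c)) :=
    Real.add_one_lt_exp (by simp [hc.ne', hne, h1.ne])
  have e2 : -(c * h * zpos c) + 1 < rexp (-(c * h * zpos c)) :=
    Real.add_one_lt_exp (by simp [hc.ne', hne, h2.ne'])
  have hlt : zpos c - zneg c <
      zpos c * rexp (-(c * h * zneg c)) - zneg c * rexp (-(c * h * zpos c)) := by
    nlinarith [mul_lt_mul_of_pos_left e1 h2, mul_lt_mul_of_neg_left e2 h1]
  unfold xi at hxi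
  rw [div_eq_one_iff_eq (by linarith)] at hxi
  exact hlt.ne hxi

/-- A globally attracting fixed point on an interval has no 2-cycles around it, so the second
iterate lies above the diagonal to its left. -/
lemma GloballyAttracting.lt_iterate_two {f : ℝ → ℝ} {a b κ x : ℝ}
    (hf : ContinuousOn f (Icc a b)) (hga : GloballyAttracting f (Icc a b) κ)
    (hx : a ≤ x) (hxκ : x < κ) : x < f (f x) := by
  obtain ⟨hmaps, hκ, -, hlim⟩ := hga
  have hfix : ∀ y ∈ Icc a b, f (f y) = y → y = κ := by
    intro y hy hfy
    have hit : ∀ n : ℕ, f^[2 * n] y = y := fun n => by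
      rw [Function.iterate_mul]
      exact Function.iterate_fixed hfy n
    have h2 : Tendsto (fun n : ℕ => 2 * n) atTop atTop :=
      tendsto_atTop_mono (fun n => Nat.le_mul_of_pos_left n two_pos) tendsto_id
    have := (hlim y hy).comp h2
    simp only [Function.comp_def, hit] at this
    exact tendsto_nhds_unique tendsto_const_nhds this
  by_contra! hle
  have hsub : Icc a x ⊆ Icc a b := Icc_subset_Icc_right (hxκ.le.trans hκ.2)
  have hcont : ContinuousOn (fun y => f (f y) - y) (Icc a x) :=
    ((hf.comp hf hmaps).mono hsub).sub continuousOn_id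
  have ha : a ∈ Icc a b := ⟨le_rfl, hκ.1.trans hκ.2⟩
  obtain ⟨y, hy, hy0⟩ := intermediate_value_Icc' hx hcont
    (show (0 : ℝ) ∈ Icc _ _ from ⟨by linarith, by linarith [(hmaps (hmaps ha)).1]⟩)
  have := hfix y (hsub hy) (by simpa [sub_eq_zero] using hy0)
  linarith [hy.2]

/-- The equality `σ κ = κ` is only possible without delay. -/
lemma eq_zero_of_sigma_fixed {g ψ σ : ℝ → ℝ} {θ θ₁ κ g₀ gκ c h : ℝ}
    (hUM : UMHyp g θ κ g₀ gκ) (hc : 0 < c) (hθκ : θ₁ < κ) (hanti : StrictAntiOn g (Icc θ₁ (g θ)))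
    (hκ : κ ∈ Icc (g (g θ)) (g θ))
    (hψ : ∀ x ∈ Icc (g (g θ)) (g θ), ψ x ∈ Icc θ₁ (g θ) ∧ g (ψ x) = x)
    (hσ : σ κ - ψ (σ κ) = (1 - xi c h) * g κ) (hσκ : σ κ = κ) : h = 0 := by
  have hgκ : g κ = κ := (hUM.fixed_pts κ hUM.kappa_pos.le).2 (Or.inr rfl)
  have hψκ : ψ κ = κ := hanti.injOn (hψ κ hκ).1 ⟨hθκ.le, hκ.2⟩ ((hψ κ hκ).2.trans hgκ.symm)
  rw [hσκ, hψκ, hgκ, sub_self, eq_comm, mul_eq_zero] at hσ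
  exact eq_zero_of_xi_eq_one hc (by linarith [hσ.resolve_right hUM.kappa_pos.ne'])

/-- under (UM) and (GA), every semi-wavefront profile converges to `κ`
at `+∞`. -/
theorem stmt5 (g : ℝ → ℝ) (θ κ g₀ gκ c h : ℝ)
    (hUM : UMHyp g θ κ g₀ gκ) (hc : 0 < c) (hh : 0 ≤ h)
    (hGA : ∃ θ₁ : ℝ, GAHyp g θ θ₁ κ c h)
    (φ : ℝ → ℝ) (hφ : SemiWavefront g c h φ) :
    Tendsto φ atTop (𝓝 κ) := by
  obtain ⟨θ₁, -, hθκ, hanti, -, ψ, σ, hψ, hσ, hattr⟩ := hGA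
  obtain ⟨B, hB⟩ := hφ.bdd
  have hBabs : ∀ t, |φ t| ≤ B := fun t => by rw [abs_of_pos (hφ.pos t)]; exact hB t
  have hgκ : g κ = κ := (hUM.fixed_pts κ hUM.kappa_pos.le).2 (Or.inr rfl)
  have hbdd : IsBoundedUnder (· ≤ ·) atTop φ := isBoundedUnder_of ⟨B, hB⟩
  have hbdd' : IsBoundedUnder (· ≥ ·) atTop φ := isBoundedUnder_of ⟨0, fun t => (hφ.pos t).le⟩
  set M := limsup φ atTop
  set m := liminf φ atTop
  have hM : ∀ ε > 0, ∀ᶠ t in atTop, φ t < M + ε := fun ε hε =>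
    eventually_lt_of_limsup_lt (lt_add_of_pos_right _ hε) hbdd
  have hm : ∀ ε > 0, ∀ᶠ t in atTop, m - ε < φ t := fun ε hε =>
    eventually_lt_of_lt_liminf (sub_lt_self _ hε) hbdd'
  have hMf : ∀ ε > 0, ∃ᶠ t in atTop, M - ε < φ t := fun ε hε =>
    frequently_lt_of_lt_limsup hbdd'.isCoboundedUnder_le (sub_lt_self _ hε)
  have hmf : ∀ ε > 0, ∃ᶠ t in atTop, φ t < m + ε := fun ε hε =>
    frequently_lt_of_liminf_lt hbdd.isCoboundedUnder_ge (lt_add_of_pos_right _ hε)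
  have hm0 : 0 ≤ m := le_liminf_of_le hbdd.isCoboundedUnder_ge
    (Eventually.of_forall fun t => (hφ.pos t).le)
  have hmpos_of : (∃ ε > 0, ∀ᶠ t in atTop, ε ≤ φ t) → 0 < m := fun ⟨ε, hε, hev⟩ =>
    hε.trans_le (le_liminf_of_le hbdd.isCoboundedUnder_ge hev)
  obtain ⟨p, hp, hMp, hpM⟩ := hφ.upper_limit_le hUM.cont hc hBabs hm0 hm hM hMf
  obtain ⟨q, hq, hqm, hqm'⟩ := hφ.le_lower_limit hUM.cont hc hBabs hm0 hm hM hmf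
  have hκ : κ ∈ Icc (g (g θ)) (g θ) := hattr.elim (fun h => h.2.1) (fun h => h.2.1)
  suffices hmM : κ ≤ m ∧ M ≤ κ from
    tendsto_of_le_liminf_of_limsup_le hmM.1 hmM.2 hbdd hbdd'
  rcases hattr with hattr | hattr
  · have hMθ : M ≤ g θ := hMp.trans (hUM.global_max p (hm0.trans hp.1))
    have hanti' : ∀ x y, κ ≤ x → x ≤ y → y ≤ g θ → g y ≤ g x := fun x y hx hxy hy =>
      hanti.antitoneOn ⟨hθκ.le.trans hx, hxy.trans hy⟩ ⟨hθκ.le.trans (hx.trans hxy), hy⟩ hxy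
    have hgθ0 : 0 ≤ g θ := hUM.nonneg θ hUM.theta_pos.le
    have ha0 : 0 < g (g θ) := by
      refine (hUM.nonneg _ hgθ0).lt_of_ne fun ha => ?_
      have hg0 : g 0 = 0 := (hUM.fixed_pts 0 self_mem_Ici).2 (Or.inl rfl)
      have hlim := hattr.2.2.2 0 ⟨ha.symm.le, hgθ0⟩
      simp only [Function.iterate_fixed hg0] at hlim
      exact hUM.kappa_pos.ne (tendsto_nhds_unique tendsto_const_nhds hlim)
    have hmpos : 0 < m := by
      have hgat : ContinuousAt g (g θ) :=
        hUM.cont.continuousAt (Ici_mem_nhds (hUM.kappa_pos.trans_le hκ.2))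
      obtain ⟨b, hb, hbg⟩ := mem_nhdsGE_iff_exists_Ico_subset.1
        (mem_nhdsWithin_of_mem_nhds (hgat.eventually (lt_mem_nhds (half_lt_self ha0))))
      have hb : g θ < b := hb
      have hlag : Tendsto (fun t : ℝ => t - c * h) atTop atTop :=
        tendsto_atTop_add_const_right _ (-(c * h)) tendsto_id
      refine hmpos_of (hφ.persistent hc hh (half_pos ha0) ?_)
      filter_upwards [hlag.eventually (hM (b - g θ) (by linarith))] with t ht h1 h2
      rcases lt_or_ge (φ (t - c * h)) κ with hlt | hge
      · exact h2.trans_lt (hUM.above_id _ (hφ.pos _) hlt)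
      · refine h1.trans ?_
        rcases le_total (φ (t - c * h)) (g θ) with hle | hle
        · exact (half_lt_self ha0).trans_le (hanti' _ _ hge hle le_rfl)
        · exact hbg ⟨hle, by linarith⟩
    have hκm : κ ≤ m := by
      by_contra! hmκ
      have hκq : κ < q := by
        by_contra! hqκ
        rcases hqκ.eq_or_lt with rfl | hlt
        · linarith
        · linarith [hUM.above_id q (hmpos.trans_le hq.1) hlt, hq.1]
      have hgM : g M ≤ m := (hanti' q M hκq.le hq.2 hMθ).trans hqm
      have hpκ : p < κ := by
        by_contra! hpκ
        linarith [hanti' κ p le_rfl hpκ (hp.2.trans hMθ), hq.2]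
      have hgp : g (g p) ≤ g M :=
        hanti' M (g p) (hκq.le.trans hq.2) hMp (hUM.global_max p (hm0.trans hp.1))
      have hap : g (g θ) ≤ p :=
        (hanti' M (g θ) (hκq.le.trans hq.2) hMθ le_rfl).trans (hgM.trans hp.1)
      have hcont : ContinuousOn g (Icc (g (g θ)) (g θ)) :=
        hUM.cont.mono fun x hx => ha0.le.trans hx.1
      linarith [hattr.lt_iterate_two hcont hap hpκ, hp.1]
    refine ⟨hκm, ?_⟩
    linarith [hanti' κ p le_rfl (hκm.trans hp.1) (hp.2.trans hMθ)]
  · have hh0 : h = 0 :=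
      eq_zero_of_sigma_fixed hUM hc hθκ hanti hκ hψ (hσ κ hκ).2 hattr.2.2.1
    have hmpos : 0 < m := by
      refine hmpos_of (hφ.persistent hc hh hUM.kappa_pos (Eventually.of_forall fun t ht _ => ?_))
      rw [hh0, mul_zero, sub_zero]
      exact hUM.above_id _ (hφ.pos t) ht
    rw [hpM hh0] at hMp
    rw [hqm' hh0] at hqm
    refine ⟨?_, ?_⟩
    · by_contra! hlt
      linarith [hUM.above_id m hmpos hlt]
    · by_contra! hlt
      linarith [hUM.below_id M hlt]

end
end

section
/- Let h ≥ 0 and c > 0, and let z₁ < 0 < z₂ be the two real roots of the quadratic equation z² − cz − 1 = 0. Then the quantity ξ(h, c) := (z₂ − z₁)/(z₂ e^{−chz₁} − z₁ e^{−chz₂}) satisfies e^{−h} ≤ ξ(h, c) ≤ 1. -/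
open Real Filter Set Topology

/-- for `h ≥ 0`, `c > 0` and `z₁ < 0 < z₂` the real roots of
`z² − cz − 1 = 0`, the quantity `ξ(h,c) = (z₂ − z₁)/(z₂ e^{−chz₁} − z₁ e^{−chz₂})`
satisfies `e^{−h} ≤ ξ(h,c) ≤ 1`. -/
theorem stmt6 (h c z₁ z₂ : ℝ) (hh : 0 ≤ h) (hc : 0 < c)
    (hz₁ : z₁ < 0) (hz₂ : 0 < z₂)
    (hz₁eq : z₁ ^ 2 - c * z₁ - 1 = 0) (hz₂eq : z₂ ^ 2 - c * z₂ - 1 = 0) :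
    Real.exp (-h) ≤
      (z₂ - z₁) / (z₂ * Real.exp (-(c * h * z₁)) - z₁ * Real.exp (-(c * h * z₂))) ∧
    (z₂ - z₁) / (z₂ * Real.exp (-(c * h * z₁)) - z₁ * Real.exp (-(c * h * z₂))) ≤ 1 := by
  have exp_le_of_root : ∀ z : ℝ, z ^ 2 - c * z - 1 = 0 →
      Real.exp (-(c * h * z)) ≤ Real.exp h := fun z hz => by
    apply Real.exp_le_exp.mpr
    have hcz : c * h * z = h * z ^ 2 - h := by linear_combination -h * hz
    nlinarith [mul_nonneg hh (sq_nonneg z)]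
  have upper₁ := mul_le_mul_of_nonneg_left (exp_le_of_root z₁ hz₁eq) hz₂.le
  have upper₂ := mul_le_mul_of_nonneg_left (exp_le_of_root z₂ hz₂eq) (neg_nonneg.mpr hz₁.le)
  have lower₁ := mul_le_mul_of_nonneg_left (Real.add_one_le_exp (-(c * h * z₁))) hz₂.le
  have lower₂ := mul_le_mul_of_nonneg_left (Real.add_one_le_exp (-(c * h * z₂)))
    (neg_nonneg.mpr hz₁.le)
  have denom_ge : z₂ - z₁ ≤
      z₂ * Real.exp (-(c * h * z₁)) - z₁ * Real.exp (-(c * h * z₂)) := by linarith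
  have denom_pos : 0 < z₂ * Real.exp (-(c * h * z₁)) - z₁ * Real.exp (-(c * h * z₂)) := by
    linarith
  refine ⟨?_, (div_le_one denom_pos).mpr denom_ge⟩
  rw [le_div_iff₀ denom_pos, Real.exp_neg, inv_mul_le_iff₀ (Real.exp_pos h)]
  linarith
end

section
/- Let c > 0, h > 0, θ > 0 and k₁ > 1, and suppose χ₀(z) = z² − cz − 1 + k₁e^{−zch} has exactly two positive real zeros μ₂ < μ₁, both simple. Set P = μ₁θ/(μ₁ − μ₂e^{−ch(μ₁−μ₂)}) and, for p ∈ (θ, P], φ(t, p) = p e^{μ₂t} + (θ − p)e^{μ₁t}. Then for each p ∈ (θ, P] one has max_{t∈[0,ch]} φ(t, p) = φ(ch, p), and the infimum over p ∈ (θ, P] of max_{t∈[0,ch]} φ(t, p) equals φ(ch, P) = k₁θ/(1 + μ₁μ₂). -/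
open Real Filter Set Topology

noncomputable section

/-- The piecewise linear birth function (DG). -/
def DGHyp (g : ℝ → ℝ) (k₁ k₂ k₃ θ θ₁ q₂ q₃ κ : ℝ) : Prop :=
  0 < θ ∧ θ < θ₁ ∧ θ₁ < κ ∧ κ < g θ ∧
  k₂ < k₃ ∧ k₃ < 0 ∧ 1 < k₁ ∧
  (∀ x : ℝ, 0 ≤ x → x ≤ θ → g x = k₁ * x) ∧
  (∀ x : ℝ, θ ≤ x → x ≤ θ₁ → g x = k₂ * x + q₂) ∧
  (∀ x : ℝ, θ₁ < x → x ≤ g θ → g x = k₃ * x + q₃) ∧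
  k₂ * θ₁ + q₂ = k₃ * θ₁ + q₃

/-- `χ` has exactly two positive real zeros `0 < μ₂ ≤ μ₁` counted with multiplicity. -/
def TwoPosZeros (χ : ℝ → ℝ) (μ₂ μ₁ : ℝ) : Prop :=
  0 < μ₂ ∧ μ₂ ≤ μ₁ ∧ χ μ₂ = 0 ∧ χ μ₁ = 0 ∧
  (∀ x : ℝ, 0 < x → χ x = 0 → x = μ₂ ∨ x = μ₁) ∧
  (μ₂ = μ₁ → deriv χ μ₁ = 0) ∧
  (μ₂ < μ₁ → deriv χ μ₂ ≠ 0 ∧ deriv χ μ₁ ≠ 0)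

/-- `χ` has exactly two negative real zeros `l₂ ≤ l₁ < 0` counted with multiplicity. -/
def TwoNegZeros (χ : ℝ → ℝ) (l₂ l₁ : ℝ) : Prop :=
  l₂ ≤ l₁ ∧ l₁ < 0 ∧ χ l₂ = 0 ∧ χ l₁ = 0 ∧
  (∀ x : ℝ, x < 0 → χ x = 0 → x = l₂ ∨ x = l₁) ∧
  (l₂ = l₁ → deriv χ l₁ = 0) ∧
  (l₂ < l₁ → deriv χ l₂ ≠ 0 ∧ deriv χ l₁ ≠ 0)

/-- `(h,c) ∈ D_L`. -/
def DLmem (g₀ gκ c h : ℝ) : Prop :=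
  ∃ μ₂ μ₁ l₂ l₁ : ℝ, TwoPosZeros (chi g₀ c h) μ₂ μ₁ ∧ TwoNegZeros (chi gκ c h) l₂ l₁

/-- The secant slope `(1 - e^{-μs})/μ` of the exponential decreases in `μ`. -/
lemma mul_one_sub_exp_le {a b s : ℝ} (ha : 0 < a) (hab : a < b) :
    a * (1 - exp (-(b * s))) ≤ b * (1 - exp (-(a * s))) := by
  have hb : 0 < b := ha.trans hab
  have hconv := convexOn_exp.2 (mem_univ (-(b * s))) (mem_univ 0)
    (div_pos ha hb).le (sub_nonneg.2 ((div_le_one hb).2 hab.le)) (add_sub_cancel (a / b) 1)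
  have harg : a / b * -(b * s) = -(a * s) := by field_simp
  simp only [smul_eq_mul, mul_zero, add_zero, exp_zero, mul_one, harg] at hconv
  have hmul := mul_le_mul_of_nonneg_left hconv hb.le
  have hexpand : b * (a / b * exp (-(b * s)) + (1 - a / b)) = a * exp (-(b * s)) + (b - a) := by
    field_simp
  linarith

/-- If the derivative of `p e^{at} - q e^{bt}` at `T` is nonnegative, then its value at `T`
dominates all earlier values. -/
lemma exp_sub_exp_le_of_deriv_nonneg {a b p q T t : ℝ} (ha : 0 < a) (hab : a < b) (hp : 0 ≤ p)
    (ht : t ≤ T) (hderiv : q * b * exp (b * T) ≤ p * a * exp (a * T)) :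
    p * exp (a * t) - q * exp (b * t) ≤ p * exp (a * T) - q * exp (b * T) := by
  have hb : 0 < b := ha.trans hab
  have hsplit (m : ℝ) : exp (m * t) = exp (m * T) * exp (-(m * (T - t))) := by
    rw [← exp_add]; congr 1; ring
  have hb_nonneg : 0 ≤ 1 - exp (-(b * (T - t))) :=
    sub_nonneg.2 (exp_le_one_iff.2 (neg_nonpos.2 (mul_nonneg hb.le (sub_nonneg.2 ht))))
  have hslope := mul_le_mul_of_nonneg_left (mul_one_sub_exp_le (s := T - t) ha hab)
    (mul_nonneg hp (exp_pos (a * T)).le)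
  have hend := mul_le_mul_of_nonneg_right hderiv hb_nonneg
  have hscaled : 0 ≤ b * (p * exp (a * T) * (1 - exp (-(a * (T - t)))) -
      q * exp (b * T) * (1 - exp (-(b * (T - t))))) := by linarith
  have hdiff := nonneg_of_mul_nonneg_right hscaled hb
  rw [hsplit a, hsplit b]
  linarith

/-- At a zero of the characteristic function, `k = (1 + cz - z²) e^{zch}`. -/
lemma eq_mul_exp_of_chi_eq_zero {k c h z : ℝ} (hz : chi k c h z = 0) :
    k = (1 + c * z - z ^ 2) * exp (z * (c * h)) := by
  have hinv : exp (-(z * c * h)) * exp (z * (c * h)) = 1 := by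
    rw [← exp_add, ← exp_zero]; congr 1; ring
  unfold chi at hz
  linear_combination exp (z * (c * h)) * hz - k * hinv

/-- for `φ(t,p) = p e^{μ₂t} + (θ − p)e^{μ₁t}` with
`p ∈ (θ, P]`, `P = μ₁θ/(μ₁ − μ₂e^{−ch(μ₁−μ₂)})`, the maximum of `φ(·,p)` on `[0,ch]`
is attained at `t = ch`, and the infimum over `p` of this maximum is
`φ(ch,P) = k₁θ/(1 + μ₁μ₂)`. -/
theorem stmt10 (c h θ k₁ μ₂ μ₁ : ℝ) (hc : 0 < c) (hh : 0 < h) (hθ : 0 < θ)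
    (hk : 1 < k₁)
    (hzeros : TwoPosZeros (chi k₁ c h) μ₂ μ₁) (hlt : μ₂ < μ₁) :
    (∀ p ∈ Ioc θ (μ₁ * θ / (μ₁ - μ₂ * Real.exp (-(c * h * (μ₁ - μ₂))))),
      ∀ t ∈ Icc (0:ℝ) (c * h),
        p * Real.exp (μ₂ * t) + (θ - p) * Real.exp (μ₁ * t) ≤
          p * Real.exp (μ₂ * (c * h)) + (θ - p) * Real.exp (μ₁ * (c * h))) ∧
    IsGLB ((fun p => sSup ((fun t => p * Real.exp (μ₂ * t) + (θ - p) * Real.exp (μ₁ * t)) ''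
          Icc (0:ℝ) (c * h))) ''
        Ioc θ (μ₁ * θ / (μ₁ - μ₂ * Real.exp (-(c * h * (μ₁ - μ₂))))))
      (k₁ * θ / (1 + μ₁ * μ₂)) ∧
    (μ₁ * θ / (μ₁ - μ₂ * Real.exp (-(c * h * (μ₁ - μ₂))))) * Real.exp (μ₂ * (c * h)) +
        (θ - μ₁ * θ / (μ₁ - μ₂ * Real.exp (-(c * h * (μ₁ - μ₂))))) * Real.exp (μ₁ * (c * h)) =
      k₁ * θ / (1 + μ₁ * μ₂) := by
  obtain ⟨h2, -, hz2, hz1, -⟩ := hzeros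
  have h1 : 0 < μ₁ := h2.trans hlt
  have hch : 0 < c * h := mul_pos hc hh
  have hk2 := eq_mul_exp_of_chi_eq_zero hz2
  have hk1 := eq_mul_exp_of_chi_eq_zero hz1
  have hratio : exp (-(c * h * (μ₁ - μ₂))) = exp (μ₂ * (c * h)) / exp (μ₁ * (c * h)) := by
    rw [← exp_sub]; congr 1; ring
  have hAB : exp (μ₂ * (c * h)) < exp (μ₁ * (c * h)) :=
    exp_lt_exp.2 (mul_lt_mul_of_pos_right hlt hch)
  have hA := exp_pos (μ₂ * (c * h))
  have hB := exp_pos (μ₁ * (c * h))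
  have hmax : ∀ p ∈ Ioc θ (μ₁ * θ / (μ₁ - μ₂ * exp (-(c * h * (μ₁ - μ₂))))),
      ∀ t ∈ Icc (0:ℝ) (c * h), p * exp (μ₂ * t) + (θ - p) * exp (μ₁ * t) ≤
        p * exp (μ₂ * (c * h)) + (θ - p) * exp (μ₁ * (c * h)) := by
    rintro p ⟨hp, hpP⟩ t ⟨-, ht⟩
    rw [hratio] at hpP
    have hden : 0 < μ₁ - μ₂ * (exp (μ₂ * (c * h)) / exp (μ₁ * (c * h))) := by
      have hlt1 := (div_lt_one hB).2 hAB
      nlinarith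
    rw [le_div_iff₀ hden] at hpP
    have hmul := mul_le_mul_of_nonneg_right hpP hB.le
    have hexpand : p * (μ₁ - μ₂ * (exp (μ₂ * (c * h)) / exp (μ₁ * (c * h)))) *
        exp (μ₁ * (c * h)) = p * μ₁ * exp (μ₁ * (c * h)) - p * μ₂ * exp (μ₂ * (c * h)) := by
      field_simp
    have hle := exp_sub_exp_le_of_deriv_nonneg (p := p) (q := p - θ) h2 hlt
      (hθ.trans hp).le ht (by linarith)
    linarith
  have hvalue : (μ₁ * θ / (μ₁ - μ₂ * exp (-(c * h * (μ₁ - μ₂))))) * exp (μ₂ * (c * h)) +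
      (θ - μ₁ * θ / (μ₁ - μ₂ * exp (-(c * h * (μ₁ - μ₂))))) * exp (μ₁ * (c * h)) =
        k₁ * θ / (1 + μ₁ * μ₂) := by
    rw [hratio]
    generalize exp (μ₂ * (c * h)) = A at *
    generalize exp (μ₁ * (c * h)) = B at *
    have hdenB : 0 < μ₁ * B - μ₂ * A := by nlinarith
    have hP : μ₁ * θ / (μ₁ - μ₂ * (A / B)) = μ₁ * θ * B / (μ₁ * B - μ₂ * A) := by
      have hden : μ₁ - μ₂ * (A / B) = (μ₁ * B - μ₂ * A) / B := by field_simp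
      rw [hden, div_div_eq_mul_div]
    have hden : 0 < 1 + μ₁ * μ₂ := by positivity
    have hkey : k₁ * (μ₁ * B - μ₂ * A) = (μ₁ - μ₂) * (1 + μ₁ * μ₂) * (A * B) := by
      linear_combination μ₁ * B * hk2 - μ₂ * A * hk1
    have hne := hdenB.ne'
    rw [hP, eq_div_iff hden.ne']
    field_simp
    linear_combination -hkey
  have hsup : ∀ p ∈ Ioc θ (μ₁ * θ / (μ₁ - μ₂ * exp (-(c * h * (μ₁ - μ₂))))),
      sSup ((fun t => p * exp (μ₂ * t) + (θ - p) * exp (μ₁ * t)) '' Icc (0:ℝ) (c * h)) =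
        p * exp (μ₂ * (c * h)) + (θ - p) * exp (μ₁ * (c * h)) := fun p hp =>
    IsGreatest.csSup_eq ⟨⟨c * h, right_mem_Icc.2 hch.le, rfl⟩, forall_mem_image.2 (hmax p hp)⟩
  have hθP : θ < μ₁ * θ / (μ₁ - μ₂ * exp (-(c * h * (μ₁ - μ₂)))) := by
    have hlt1 : exp (-(c * h * (μ₁ - μ₂))) < 1 := hratio ▸ (div_lt_one hB).2 hAB
    have hpos := exp_pos (-(c * h * (μ₁ - μ₂)))
    rw [lt_div_iff₀ (by nlinarith)]
    nlinarith [mul_pos hθ (mul_pos h2 hpos)]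
  refine ⟨hmax, IsLeast.isGLB ⟨⟨_, right_mem_Ioc.2 hθP, ?_⟩, ?_⟩, hvalue⟩
  · exact (hsup _ (right_mem_Ioc.2 hθP)).trans hvalue
  · rintro _ ⟨p, hp, rfl⟩
    dsimp only
    rw [hsup p hp, ← hvalue]
    linarith [mul_le_mul_of_nonneg_right hp.2 (sub_nonneg.2 hAB.le)]

end
end
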